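/- arXiv:math/0203012 — 3 statements merged into one kernel-verified Lean document; each statement's English description precedes it below -/
import Mathlib

section
/- For every chord diagram D, the colored Jones weight system equals the permanent of the blown-up intersection matrix: W_J(D) = Per(IM_J(D)) in ℚ[λ]. -/
open Finset

/-! ### Permanents -/

/-- The permanent of a square matrix. -/
noncomputable def perm {ι R : Type*} [Fintype ι] [DecidableEq ι] [CommRing R]
    (M : Matrix ι ι R) : R :=
  ∑ σ : Equiv.Perm ι, ∏ i, M i (σ i)

/-! ### Chord diagrams -/

/-- A chord diagram with `n` chords: a partition of `{1,…,2n}` into `n` two-element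
subsets (chords), each recorded by its left endpoint `l i` and right endpoint `r i`,
with the chords numbered in increasing order of their left endpoints. -/
structure ChordDiagram (n : ℕ) where
  l : Fin n → Fin (2 * n)
  r : Fin n → Fin (2 * n)
  lr : ∀ i, l i < r i
  mono : StrictMono l
  cover : ∀ q : Fin (2 * n), ∃! i : Fin n, l i = q ∨ r i = q

namespace ChordDiagram

variable {n : ℕ}

/-- Chords `i` and `j` intersect. -/
abbrev Intersect (D : ChordDiagram n) (i j : Fin n) : Prop :=
  (D.l i < D.l j ∧ D.l j < D.r i ∧ D.r i < D.r j) ∨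
  (D.l j < D.l i ∧ D.l i < D.r j ∧ D.r j < D.r i)

/-- Chord `i` is completely contained in chord `j`. -/
abbrev Contained (D : ChordDiagram n) (i j : Fin n) : Prop :=
  D.l j < D.l i ∧ D.r i < D.r j

/-- The five colors `I, B⁺₀, B⁺₁, B⁻₀, B⁻₁` (`true` encodes subscript `1`). -/
inductive JCol where
  | I : JCol
  | Bp : Bool → JCol
  | Bm : Bool → JCol
  deriving DecidableEq, Fintype

/-- The contribution `δ` of a left endpoint of a chord with a given color. -/
def lsign : JCol → ℤ
  | .Bp true => 1
  | .Bm true => -1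
  | _ => 0

/-- `δ(q)` for a coloring `ρ` of the chords of `D`. -/
def delta (D : ChordDiagram n) (ρ : Fin n → JCol) (q : Fin (2 * n)) : ℤ :=
  ∑ v : Fin n, ((if D.l v = q then lsign (ρ v) else 0) +
                (if D.r v = q then - lsign (ρ v) else 0))

/-- `Σ_{q < p} δ(q)`. -/
def kOf (D : ChordDiagram n) (ρ : Fin n → JCol) (p : Fin (2 * n)) : ℤ :=
  ∑ q ∈ univ.filter (fun q => q < p), D.delta ρ q

/-- The weight `ω_ρ(v)` of chord `v` under the coloring `ρ`. -/
noncomputable def omega (D : ChordDiagram n) (ρ : Fin n → JCol) (v : Fin n) :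
    Polynomial ℚ :=
  match ρ v with
  | .I => Polynomial.X + 2
  | .Bp ε => - (-1 : Polynomial ℚ) ^ (if ε then 1 else 0) *
      (1 + ((D.kOf ρ (D.l v) : ℤ) : Polynomial ℚ)) *
      (Polynomial.X + 1 - ((D.kOf ρ (D.r v) : ℤ) : Polynomial ℚ))
  | .Bm ε => - (-1 : Polynomial ℚ) ^ (if ε then 1 else 0) *
      (1 + ((D.kOf ρ (D.r v) : ℤ) : Polynomial ℚ)) *
      (Polynomial.X + 1 - ((D.kOf ρ (D.l v) : ℤ) : Polynomial ℚ))

/-- The colored Jones weight system `W_J(D) ∈ ℚ[λ]` (with `λ = X`). -/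
noncomputable def WJ (D : ChordDiagram n) : Polynomial ℚ :=
  ∑ ρ : Fin n → JCol, ∏ v : Fin n, D.omega ρ v

/-- The intersection matrix `IM(D)` with entries `sign(i−j)` for intersecting chords. -/
def IM (D : ChordDiagram n) : Matrix (Fin n) (Fin n) ℚ := fun i j =>
  if D.Intersect i j then (if j < i then 1 else if i < j then -1 else 0) else 0

/-- The `3×3` block `A₀`. -/
noncomputable def A0 : Matrix (Fin 3) (Fin 3) (Polynomial ℚ) :=
  !![Polynomial.X + 2, 0, 0; 0, Polynomial.X + 2, 1; Polynomial.X, -Polynomial.X - 2, 1]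

/-- The `3×3` block `A₊`. -/
noncomputable def Aplus : Matrix (Fin 3) (Fin 3) (Polynomial ℚ) := !![1, 1, 0; 0, 0, 0; 0, 0, 0]

/-- The `3×3` block `A₋`. -/
noncomputable def Aminus : Matrix (Fin 3) (Fin 3) (Polynomial ℚ) := !![0, 0, 0; -1, -1, 0; 0, 0, 0]

/-- The `3×3` block `A_c`. -/
noncomputable def Acont : Matrix (Fin 3) (Fin 3) (Polynomial ℚ) := !![1, 1, 0; -1, -1, 0; 0, 0, 0]

/-- The blown-up intersection matrix `IM_J(D)`, a `3n×3n` matrix of `3×3` blocks. -/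
noncomputable def IMJ (D : ChordDiagram n) :
    Matrix (Fin n × Fin 3) (Fin n × Fin 3) (Polynomial ℚ) := fun p q =>
  (if p.1 = q.1 then A0
   else if q.1 < p.1 ∧ D.Intersect p.1 q.1 then Aplus
   else if p.1 < q.1 ∧ D.Intersect p.1 q.1 then Aminus
   else if ¬ D.Intersect p.1 q.1 ∧ D.Contained p.1 q.1 then Acont
   else 0) p.2 q.2

end ChordDiagram

/-! ### Looped digraphs -/

/-- A looped digraph: a finite digraph (arcs a set of ordered pairs) with a loop at
every vertex and a distinguished set of red non-loop arcs. -/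
structure LoopedDigraph (V : Type*) [Fintype V] [DecidableEq V] where
  arcs : Finset (V × V)
  red : Finset (V × V)
  loop_mem : ∀ v : V, (v, v) ∈ arcs
  red_sub : red ⊆ arcs
  red_no_loop : ∀ v : V, (v, v) ∉ red

/-- A thickened arc `(e, b)`, where `e` is an arc of the digraph and `b : Bool` records:
for an uncolored arc, whether it is thickened at its tail (`true`) or head (`false`);
for a red arc (always thickened at its tail `e.1`), whether it keeps its original
orientation (`true`) or is reversed (`false`). Loops always carry `b = true`. -/
abbrev TArc (V : Type*) := (V × V) × Bool

variable {V : Type*} [Fintype V] [DecidableEq V]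

/-- The degree of `v` in a collection `K` of thickened arcs: the number of arc-ends of
`K` at `v` (a loop contributing `2`). -/
def degAt (K : Finset (TArc V)) (v : V) : ℕ :=
  ∑ t ∈ K, ((if t.1.1 = v then 1 else 0) + (if t.1.2 = v then 1 else 0))

/-- `deg₄(K)`: the number of vertices of degree `4` in `K`. -/
def deg4 (K : Finset (TArc V)) : ℕ := (univ.filter fun v => degAt K v = 4).card

namespace LoopedDigraph

variable (G : LoopedDigraph V)

/-- The initial vertex of a thickened arc, as oriented in the collection. -/
def src (t : TArc V) : V := if t.1 ∈ G.red ∧ t.2 = false then t.1.2 else t.1.1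

/-- The terminal vertex of a thickened arc, as oriented in the collection. -/
def dst (t : TArc V) : V := if t.1 ∈ G.red ∧ t.2 = false then t.1.1 else t.1.2

/-- The vertex at which a thickened arc is thickened. -/
def tvert (t : TArc V) : V := if t.1 ∈ G.red then t.1.1 else if t.2 then t.1.1 else t.1.2

/-- The number of arcs of `K` thickened at `v`. -/
def thickAt (K : Finset (TArc V)) (v : V) : ℕ := (K.filter fun t => G.tvert t = v).card

/-- The number of arcs of `K` thickened at `v` that leave `v` (a loop counting as
leaving). -/
def outThickAt (K : Finset (TArc V)) (v : V) : ℕ :=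
  (K.filter fun t => G.tvert t = v ∧ G.src t = v).card

/-- An acceptable object for a looped digraph. -/
structure IsAcceptable (K : Finset (TArc V)) : Prop where
  mem_arcs : ∀ t ∈ K, t.1 ∈ G.arcs
  loop_thick : ∀ t ∈ K, t.1.1 = t.1.2 → t.2 = true
  deg024 : ∀ v, degAt K v = 0 ∨ degAt K v = 2 ∨ degAt K v = 4
  half_thick : ∀ v, 2 * G.thickAt K v = degAt K v
  balance : ∀ v, G.thickAt K v = 2 → G.outThickAt K v = 1

/-- `a(K)`: the number of arcs of `K` thickened at their initial vertex (loops count). -/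
def aK (K : Finset (TArc V)) : ℕ := (K.filter fun t => G.src t = G.tvert t).card

open Classical in
/-- The partition function `J(G)`, with `λ ↦ lam` and `x_e ↦ x e`. -/
noncomputable def J {R : Type*} [CommRing R] (lam : R) (x : V × V → R) : R :=
  ∑ K : Finset (TArc V),
    if G.IsAcceptable K then
      2 ^ deg4 K * (lam + 2) ^ (Fintype.card V - deg4 K) *
        (∏ t ∈ K, x t.1) * (-1 : R) ^ G.aK K
    else 0

/-- `s(w) = δ_w · ε_w` for a partial coloring `c` (with support the set `V′`). -/
def sInt (c : V → Option (Bool × Bool)) (w : V) : ℤ :=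
  match c w with
  | none => 0
  | some (δ, ε) => (if δ then 1 else -1) * (if ε then 1 else 0)

/-- `z_v(e)` (for `bar = false`) and `z̄_v(e)` (for `bar = true`). -/
def zfun {R : Type*} [CommRing R] (x : V × V → R) (c : V → Option (Bool × Bool))
    (bar : Bool) (v : V) (e : V × V) : R :=
  match c v with
  | none => 0
  | some (δ, _) =>
    if e ∈ G.red then
      (if e.1 = v then ((sInt c e.2 : ℤ) : R) * x e else 0)
    else if e.1 = v then (if δ = bar then ((sInt c e.2 : ℤ) : R) * x e else 0)
    else if e.2 = v then (if δ ≠ bar then ((sInt c e.1 : ℤ) : R) * x e else 0)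
    else 0

/-- The weight `ω′_c(v)`. -/
noncomputable def omegaC {R : Type*} [CommRing R] (lam : R) (x : V × V → R)
    (c : V → Option (Bool × Bool)) (v : V) : R :=
  match c v with
  | none => 0
  | some (_, ε) =>
    - (-1 : R) ^ (if ε then 1 else 0) *
      (1 + ∑ e ∈ G.arcs, G.zfun x c false v e) *
      (lam + 1 - ∑ e ∈ G.arcs, G.zfun x c true v e)

/-- The state sum `J′(G)`: the sum over `V′ ⊆ V` and colorings `c` of `V′` is encoded
as a sum over partial colorings `c : V → Option (Bool × Bool)` with support `V′`. -/
noncomputable def J' {R : Type*} [CommRing R] (lam : R) (x : V × V → R) : R :=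
  ∑ c : V → Option (Bool × Bool),
    (lam + 2) ^ (univ.filter fun v => c v = none).card *
      ∏ v ∈ univ.filter (fun v => (c v).isSome = true), G.omegaC lam x c v

end LoopedDigraph

/-! ### The labeled intersection digraph of a chord diagram -/

open ChordDiagram in
/-- The labeled intersection digraph `LID(D)` of a chord diagram `D`. -/
def LID {n : ℕ} (D : ChordDiagram n) : LoopedDigraph (Fin n) where
  arcs := univ.filter fun p : Fin n × Fin n =>
    p.1 = p.2 ∨ (p.1 < p.2 ∧ D.Intersect p.1 p.2) ∨ D.Contained p.1 p.2
  red := univ.filter fun p : Fin n × Fin n => D.Contained p.1 p.2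
  loop_mem := by intro v; simp
  red_sub := by intro p hp; simp only [mem_filter, mem_univ, true_and] at hp ⊢; tauto
  red_no_loop := by
    intro v hv
    simp only [mem_filter, mem_univ, true_and] at hv
    exact lt_irrefl _ hv.1

/-! ### The data `(V′, h)` and the state sum `A(V′, h)` -/

/-- The data of a function `h` assigning to every `v ∈ V′` a set of at most two arcs of
`G` incident with `v`, every red arc of `h v` leaving `v` (and `h v = ∅` off `V′`). -/
structure HData (G : LoopedDigraph V) (V' : Finset V) where
  h : V → Finset (V × V)
  sub : ∀ v, h v ⊆ G.arcs
  card_le : ∀ v, (h v).card ≤ 2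
  incident : ∀ v, ∀ e ∈ h v, e.1 = v ∨ e.2 = v
  red_out : ∀ v, ∀ e ∈ h v, e ∈ G.red → e.1 = v
  outside : ∀ v, v ∉ V' → h v = ∅

/-- The number of arc-ends at `v` among a set of thickened arcs `(e, w)`. -/
def endCountAt (S : Finset ((V × V) × V)) (v : V) : ℕ :=
  ∑ p ∈ S, ((if p.1.1 = v then 1 else 0) + (if p.1.2 = v then 1 else 0))

namespace HData

variable {G : LoopedDigraph V} {V' : Finset V} (H : HData G V')

/-- `W₁ = {v ∈ V′ : |h(v)| = 2}`. -/
def W1 : Finset V := V'.filter fun v => (H.h v).card = 2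

/-- `W₂ = {v ∈ V′ : |h(v)| ≥ 1}`. -/
def W2 : Finset V := V'.filter fun v => 1 ≤ (H.h v).card

/-- `h(W₂)`: the set of thickened arcs `(e, v)` with `v ∈ W₂` and `e ∈ h v`. -/
def hW2 : Finset ((V × V) × V) :=
  univ.filter fun p => p.2 ∈ H.W2 ∧ p.1 ∈ H.h p.2

/-- The functions `g` on `S` with `g v ∈ h v`, encoded as singleton-valued selections
`gs : V → Finset (V × V)` (with `gs v = ∅` off `S`). -/
def choices (S : Finset V) : Finset (V → Finset (V × V)) :=
  univ.filter fun gs => ∀ v, gs v ⊆ H.h v ∧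
    (v ∈ S → (gs v).card = 1) ∧ (v ∉ S → gs v = ∅)

/-- The summand `B(c, V₂′, g)`; here `g` is encoded by the selection `gs` on
`W₁ ∪ V₂′` and the complementary function `f` (on `W₁ ∪ V₁′`, `V₁′ = W₂∖(W₁∪V₂′)`)
is encoded by the complementary selection `h v ∖ gs v`. -/
noncomputable def Bterm {R : Type*} [CommRing R] (lam : R) (x : V × V → R)
    (c : V → Option (Bool × Bool)) (V2 : Finset V) (gs : V → Finset (V × V)) : R :=
  (-1 : R) ^ (∑ v ∈ V', ((c v).elim 0 fun p => if p.2 then 1 else 0 : ℕ)) *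
  (-1 : R) ^ (H.W1 ∪ V2).card *
  (lam + 1) ^ (V' \ (H.W1 ∪ V2)).card *
  (∏ v ∈ H.W1 ∪ V2, ∏ e ∈ gs v, G.zfun x c true v e) *
  (∏ v ∈ H.W1 ∪ (H.W2 \ (H.W1 ∪ V2)), ∏ e ∈ H.h v \ gs v, G.zfun x c false v e)

open Classical in
/-- The state sum `A(V′, h)`. -/
noncomputable def Aval {R : Type*} [CommRing R] (lam : R) (x : V × V → R) : R :=
  ∑ c : V → Option (Bool × Bool),
    if (∀ v, (c v).isSome = true ↔ v ∈ V') then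
      ∑ V2 ∈ (H.W2 \ H.W1).powerset, ∑ gs ∈ H.choices (H.W1 ∪ V2),
        H.Bterm lam x c V2 gs
    else 0

end HData

/-! ### Good collections and the state sum `C(X, V′, K)` -/

namespace LoopedDigraph

/-- A collection of thickened arcs good on `V′`. -/
structure IsGood (G : LoopedDigraph V) (V' : Finset V) (K : Finset (TArc V)) : Prop where
  mem_arcs : ∀ t ∈ K, t.1 ∈ G.arcs
  loop_thick : ∀ t ∈ K, t.1.1 = t.1.2 → t.2 = true
  red_orig : ∀ t ∈ K, t.1 ∈ G.red → t.2 = true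
  deg_mem : ∀ v ∈ V', degAt K v = 2 ∨ degAt K v = 4
  deg_out : ∀ v, v ∉ V' → degAt K v = 0
  half_thick : ∀ v, 2 * G.thickAt K v = degAt K v
  unc_opp : ∀ t ∈ K, ∀ s ∈ K, t ≠ s → t.1 ∉ G.red → s.1 ∉ G.red →
    G.tvert t = G.tvert s → ((G.src t = G.tvert t) ↔ ¬ (G.src s = G.tvert s))

/-- The set `W₁` of degree-4 vertices of a collection `K`. -/
def KW1 (G : LoopedDigraph V) (K : Finset (TArc V)) : Finset V :=
  univ.filter fun v => degAt K v = 4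

/-- The arcs of `K` thickened at `v`. -/
def thickedAt (G : LoopedDigraph V) (K : Finset (TArc V)) (v : V) : Finset (TArc V) :=
  K.filter fun t => G.tvert t = v

/-- The functions `g′` assigning to each degree-4 vertex one of the two arcs of `K`
thickened at it, encoded as singleton-valued selections. -/
def kchoices (G : LoopedDigraph V) (K : Finset (TArc V)) : Finset (V → Finset (TArc V)) :=
  univ.filter fun cs => ∀ v, cs v ⊆ G.thickedAt K v ∧
    (v ∈ KW1 G K → (cs v).card = 1) ∧ (v ∉ KW1 G K → cs v = ∅)

open Classical in
/-- The state sum `C(X, V′, K)`. -/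
noncomputable def Cval {R : Type*} [CommRing R] (G : LoopedDigraph V) (V' : Finset V)
    (K : Finset (TArc V)) (X : Finset V) (x : V × V → R) : R :=
  ∑ cs ∈ kchoices G K,
    (-1 : R) ^ (KW1 G K).card * (-1 : R) ^ X.card *
    ∑ c : V → Option (Bool × Bool),
      if (∀ v, (c v).isSome = true ↔ v ∈ V') then
        (∏ v ∈ KW1 G K ∪ X,
          ∏ t ∈ (if v ∈ KW1 G K then cs v else G.thickedAt K v), G.zfun x c true v t.1) *
        (∏ v ∈ V' \ X, ∏ t ∈ G.thickedAt K v \ cs v, G.zfun x c false v t.1)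
      else 0

/-- A connected acceptable object: one with no single loops. -/
def IsConnectedObj (G : LoopedDigraph V) (K : Finset (TArc V)) : Prop :=
  G.IsAcceptable K ∧ ∀ t ∈ K, t.1.1 = t.1.2 → degAt K t.1.1 ≠ 2

/-- A super acceptable object: connected, and every vertex has degree at least 2. -/
def IsSuper (G : LoopedDigraph V) (K : Finset (TArc V)) : Prop :=
  G.IsConnectedObj K ∧ ∀ v, 2 ≤ degAt K v

end LoopedDigraph

/-! ### A Ryser-type formula -/

section Helpers

/-- Regrouping a product along an optional selection map. -/
lemma aux_prod_fiber {V R : Type*} [Fintype V] [DecidableEq V] [CommRing R]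
    (o : V → Option V) (f : V → R) :
    ∏ v, (o v).elim 1 f = ∏ w, f w ^ (∑ v, if o v = some w then 1 else 0 : ℕ) := by
  have h : ∀ w, f w ^ (∑ v, if o v = some w then 1 else 0 : ℕ)
      = ∏ v, if o v = some w then f w else 1 := by
    intro w
    rw [← Finset.prod_pow_eq_pow_sum]
    refine Finset.prod_congr rfl fun v _ => ?_
    split_ifs <;> simp
  simp_rw [h]
  rw [Finset.prod_comm]
  refine Finset.prod_congr rfl fun v _ => ?_
  cases hv : o v with
  | none => simp
  | some w => simp

/-- Ryser's formula. -/
lemma aux_ryser {ι R : Type*} [Fintype ι] [DecidableEq ι] [CommRing R]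
    (M : Matrix ι ι R) :
    perm M = ∑ x : ι → Bool, (∏ j, (if x j then (1 : R) else -1)) *
      ∏ i, ∑ j, M i j * (if x j then 1 else 0) := by
  have h1 : ∀ x : ι → Bool, ∏ i, ∑ j, M i j * (if x j then (1:R) else 0)
      = ∑ τ : ι → ι, (∏ i, M i (τ i)) * ∏ j, (if x j then (1:R) else 0) ^
          (∑ i, if τ i = j then 1 else 0 : ℕ) := by
    intro x
    rw [Finset.prod_univ_sum, Fintype.piFinset_univ]
    refine Finset.sum_congr rfl fun τ _ => ?_
    rw [Finset.prod_mul_distrib]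
    congr 1
    have := aux_prod_fiber (fun i => some (τ i)) (fun j => if x j then (1:R) else 0)
    simpa using this
  simp_rw [h1, Finset.mul_sum]
  rw [Finset.sum_comm]
  have h2 : ∀ τ : ι → ι, ∑ x : ι → Bool, (∏ j, (if x j then (1 : R) else -1)) *
      ((∏ i, M i (τ i)) * ∏ j, (if x j then (1:R) else 0) ^
          (∑ i, if τ i = j then 1 else 0 : ℕ))
      = if Function.Bijective τ then ∏ i, M i (τ i) else 0 := by
    intro τ
    have h3 : ∀ x : ι → Bool, (∏ j, (if x j then (1 : R) else -1)) *
      ((∏ i, M i (τ i)) * ∏ j, (if x j then (1:R) else 0) ^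
          (∑ i, if τ i = j then 1 else 0 : ℕ))
        = (∏ i, M i (τ i)) * ∏ j, ((if x j then (1 : R) else -1) * (if x j then (1:R) else 0) ^
          (∑ i, if τ i = j then 1 else 0 : ℕ)) := by
      intro x
      rw [Finset.prod_mul_distrib]
      ring
    simp_rw [h3]
    rw [← Finset.mul_sum]
    have h4 := Finset.prod_univ_sum (fun _ : ι => (Finset.univ : Finset Bool))
      (fun j b => (if b then (1 : R) else -1) * (if b then (1:R) else 0) ^
          (∑ i, if τ i = j then 1 else 0 : ℕ))
    rw [Fintype.piFinset_univ] at h4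
    rw [← h4]
    have h5 : ∀ j, ∑ b : Bool, (if b then (1 : R) else -1) * (if b then (1:R) else 0) ^
          (∑ i, if τ i = j then 1 else 0 : ℕ) = if ∃ i, τ i = j then 1 else 0 := by
      intro j
      by_cases hj : ∃ i, τ i = j
      · have : (∑ i, if τ i = j then 1 else 0 : ℕ) ≠ 0 := by
          obtain ⟨i, hi⟩ := hj
          intro h0
          have := (Finset.sum_eq_zero_iff.mp h0) i (Finset.mem_univ i)
          simp [hi] at this
        rw [if_pos hj, Fintype.sum_bool]
        simp only [if_true, one_pow, Bool.false_eq_true, if_false, zero_pow this]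
        ring
      · have : (∑ i, if τ i = j then 1 else 0 : ℕ) = 0 := by
          refine Finset.sum_eq_zero fun i _ => ?_
          rw [if_neg fun h => hj ⟨i, h⟩]
        rw [if_neg hj, this]
        simp
    simp_rw [h5]
    by_cases hb : Function.Bijective τ
    · rw [if_pos hb]
      rw [Finset.prod_congr rfl (fun j _ => if_pos (hb.2 j))]
      simp
    · rw [if_neg hb]
      have : ¬ Function.Surjective τ := fun hs => hb (Finite.surjective_iff_bijective.mp hs)
      simp only [Function.Surjective, not_forall] at this
      obtain ⟨j, hj⟩ := this
      have hz : ∏ j, (if ∃ i, τ i = j then (1 : R) else 0) = 0 :=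
        Finset.prod_eq_zero (Finset.mem_univ j) (if_neg hj)
      rw [hz, mul_zero]
  simp_rw [h2]
  rw [← Finset.sum_filter, perm]
  refine Finset.sum_bij (fun σ _ => (σ : ι → ι)) ?_ ?_ ?_ ?_
  · intro σ _
    simp
  · intro σ _ σ' _ h
    exact DFunLike.coe_injective h
  · intro τ hτ
    exact ⟨Equiv.ofBijective τ (by simpa using hτ), Finset.mem_univ _, rfl⟩
  · intro σ _
    rfl

/-! ### Local state sums -/

/-- The moments of the local weights. -/
def aux_mom {T R : Type*} [Fintype T] [CommRing R]
    (s : T → R) (c : T → Bool → Bool → R) (e₁ e₂ : Bool) (d : ℕ) : R :=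
  ∑ t, c t e₁ e₂ * s t ^ d

/-- The multiaffine state sum. -/
def aux_Z {V T R : Type*} [Fintype V] [DecidableEq V] [Fintype T] [CommRing R]
    (P Q : V → V → R) (s : T → R) (c : T → Bool → Bool → R) : R :=
  ∑ t : V → T, ∏ v, (c (t v) false false + c (t v) true false * (∑ w, P v w * s (t w))
    + c (t v) false true * (∑ w, Q v w * s (t w))
    + c (t v) true true * ((∑ w, P v w * s (t w)) * (∑ w, Q v w * s (t w))))

/-- In-degree of a pair of selection maps. -/
def aux_deg {V : Type*} [Fintype V] [DecidableEq V] (O : V → Option V × Option V) (w : V) : ℕ :=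
  (∑ v, if (O v).1 = some w then 1 else 0) + (∑ v, if (O v).2 = some w then 1 else 0)

lemma aux_Z_expand {V T R : Type*} [Fintype V] [DecidableEq V] [Fintype T] [CommRing R]
    (P Q : V → V → R) (s : T → R) (c : T → Bool → Bool → R) :
    aux_Z P Q s c = ∑ O : V → Option V × Option V,
      (∏ v, (O v).1.elim 1 (P v) * (O v).2.elim 1 (Q v)) *
        ∏ w, aux_mom s c (O w).1.isSome (O w).2.isSome (aux_deg O w) := by
  classical
  have h1 : ∀ (t : V → T) (v : V),
      (c (t v) false false + c (t v) true false * (∑ w, P v w * s (t w))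
        + c (t v) false true * (∑ w, Q v w * s (t w))
        + c (t v) true true * ((∑ w, P v w * s (t w)) * (∑ w, Q v w * s (t w))))
      = ∑ o : Option V × Option V, (o.1.elim 1 (P v) * o.2.elim 1 (Q v)) *
          (c (t v) o.1.isSome o.2.isSome *
            (o.1.elim 1 (fun w => s (t w)) * o.2.elim 1 (fun w => s (t w)))) := by
    intro t v
    rw [Fintype.sum_prod_type, Fintype.sum_option]
    simp_rw [Fintype.sum_option]
    simp only [Option.elim_none, Option.elim_some, Option.isSome_none, Option.isSome_some]
    rw [Finset.sum_add_distrib, Finset.sum_mul_sum, Finset.mul_sum, Finset.mul_sum, Finset.mul_sum]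
    simp_rw [Finset.mul_sum]
    have e1 : ∀ x : V, c (t v) true false * (P v x * s (t x))
      = P v x * 1 * (c (t v) true false * (s (t x) * 1)) := fun x => by ring
    have e2 : ∀ x : V, c (t v) false true * (Q v x * s (t x))
      = 1 * Q v x * (c (t v) false true * (1 * s (t x))) := fun x => by ring
    have e3 : ∀ x y : V, c (t v) true true * (P v x * s (t x) * (Q v y * s (t y)))
      = P v x * Q v y * (c (t v) true true * (s (t x) * s (t y))) := fun x y => by ring
    simp_rw [e1, e2, e3]
    ring
  unfold aux_Z
  simp_rw [h1, Finset.prod_univ_sum, Fintype.piFinset_univ]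
  rw [Finset.sum_comm]
  refine Finset.sum_congr rfl fun O _ => ?_
  have e : ∀ (u : V → Option V) (t : V → T), ∏ v, (u v).elim 1 (fun w => s (t w))
     = ∏ w, s (t w) ^ (∑ v, if u v = some w then 1 else 0 : ℕ) := fun u t =>
    aux_prod_fiber u (fun w => s (t w))
  have e1 := e (fun v => (O v).1)
  have e2 := e (fun v => (O v).2)
  simp_rw [Finset.prod_mul_distrib, e1, e2]
  rw [← Finset.mul_sum]
  congr 1
  unfold aux_mom
  rw [Finset.prod_univ_sum, Fintype.piFinset_univ]
  refine Finset.sum_congr rfl fun t _ => ?_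
  simp_rw [aux_deg, pow_add, Finset.prod_mul_distrib]

lemma aux_deg_sum {V : Type*} [Fintype V] [DecidableEq V] (O : V → Option V × Option V) :
    ∑ w, aux_deg O w = ∑ w, ((O w).1.isSome.toNat + (O w).2.isSome.toNat) := by
  have h : ∀ u : V → Option V, ∑ w, ∑ v, (if u v = some w then 1 else 0 : ℕ)
      = ∑ v, (u v).isSome.toNat := by
    intro u
    rw [Finset.sum_comm]
    refine Finset.sum_congr rfl fun v _ => ?_
    cases u v <;> simp
  unfold aux_deg
  rw [Finset.sum_add_distrib, Finset.sum_add_distrib, h (fun v => (O v).1), h (fun v => (O v).2)]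

/-- The state sum depends only on the leading moments. -/
lemma aux_Z_congr {V T T₂ R : Type*} [Fintype V] [DecidableEq V] [Fintype T] [Fintype T₂]
    [CommRing R] (P Q : V → V → R) (s : T → R) (c : T → Bool → Bool → R)
    (s₂ : T₂ → R) (c₂ : T₂ → Bool → Bool → R)
    (h0 : ∀ e₁ e₂ d, d < e₁.toNat + e₂.toNat → aux_mom s c e₁ e₂ d = 0)
    (h02 : ∀ e₁ e₂ d, d < e₁.toNat + e₂.toNat → aux_mom s₂ c₂ e₁ e₂ d = 0)
    (h : ∀ e₁ e₂, aux_mom s c e₁ e₂ (e₁.toNat + e₂.toNat)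
      = aux_mom s₂ c₂ e₁ e₂ (e₁.toNat + e₂.toNat)) :
    aux_Z P Q s c = aux_Z P Q s₂ c₂ := by
  rw [aux_Z_expand, aux_Z_expand]
  refine Finset.sum_congr rfl fun O _ => ?_
  congr 1
  by_cases hl : ∃ w, aux_deg O w < (O w).1.isSome.toNat + (O w).2.isSome.toNat
  · obtain ⟨w, hw⟩ := hl
    rw [Finset.prod_eq_zero (Finset.mem_univ w) (h0 _ _ _ hw),
      Finset.prod_eq_zero (Finset.mem_univ w) (h02 _ _ _ hw)]
  · push Not at hl
    have := (Finset.sum_eq_sum_iff_of_le (fun w _ => hl w)).mp (aux_deg_sum O).symm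
    refine Finset.prod_congr rfl fun w hw => ?_
    rw [← this w hw, h]

end Helpers

/-! ### Specialisation to chord diagrams -/

namespace ChordDiagram

open Polynomial

variable {n : ℕ}

/-- Coefficients of `k_v`. -/
def auxP (D : ChordDiagram n) (v w : Fin n) : ℤ :=
  if D.l w < D.l v ∧ D.l v < D.r w then 1 else 0

/-- Coefficients of the second k (without the self-contribution). -/
def auxQ (D : ChordDiagram n) (v w : Fin n) : ℤ :=
  if w ≠ v ∧ D.l w < D.r v ∧ D.r v < D.r w then 1 else 0

lemma aux_l_ne_r (D : ChordDiagram n) (v w : Fin n) : D.l v ≠ D.r w := by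
  intro h
  obtain ⟨i, _, hi⟩ := D.cover (D.l v)
  have h1 := hi v (Or.inl rfl)
  have h2 := hi w (Or.inr h.symm)
  have : v = w := h1.trans h2.symm
  subst this
  exact (D.lr v).ne h

lemma aux_r_inj (D : ChordDiagram n) {v w : Fin n} (h : D.r v = D.r w) : v = w := by
  obtain ⟨i, _, hi⟩ := D.cover (D.r v)
  exact (hi v (Or.inr rfl)).trans (hi w (Or.inr h.symm)).symm

lemma aux_kOf (D : ChordDiagram n) (ρ : Fin n → JCol) (p : Fin (2 * n)) :
    D.kOf ρ p = ∑ v, ((if D.l v < p then lsign (ρ v) else 0)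
      - (if D.r v < p then lsign (ρ v) else 0)) := by
  unfold kOf delta
  rw [Finset.sum_comm]
  refine Finset.sum_congr rfl fun v _ => ?_
  rw [Finset.sum_add_distrib, Finset.sum_ite_eq, Finset.sum_ite_eq]
  simp only [Finset.mem_filter, Finset.mem_univ, true_and]
  split_ifs <;> ring

lemma aux_kOf_l (D : ChordDiagram n) (ρ : Fin n → JCol) (v : Fin n) :
    D.kOf ρ (D.l v) = ∑ w, D.auxP v w * lsign (ρ w) := by
  rw [aux_kOf]
  refine Finset.sum_congr rfl fun w _ => ?_
  have h1 := D.lr w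
  have h2 := D.aux_l_ne_r v w
  unfold auxP
  grind

lemma aux_kOf_r (D : ChordDiagram n) (ρ : Fin n → JCol) (v : Fin n) :
    D.kOf ρ (D.r v) = lsign (ρ v) + ∑ w, D.auxQ v w * lsign (ρ w) := by
  rw [aux_kOf]
  have : lsign (ρ v) = ∑ w, if w = v then lsign (ρ w) else 0 := by simp
  rw [this, ← Finset.sum_add_distrib]
  refine Finset.sum_congr rfl fun w _ => ?_
  have h1 := D.lr w
  have h2 := D.aux_l_ne_r w v
  have h3 : D.r v = D.r w → v = w := D.aux_r_inj
  unfold auxQ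
  by_cases hw : w = v
  · subst hw; simp [h1]
  · have h33 : D.r v ≠ D.r w := fun h => hw (h3 h).symm
    grind

/-- Local weights of the colouring state sum. -/
noncomputable def auxC : JCol → Bool → Bool → ℚ[X]
  | .I, false, false => X + 2
  | .I, _, _ => 0
  | .Bp false, false, false => -(X + 1)
  | .Bp false, true, false => -(X + 1)
  | .Bp false, false, true => 1
  | .Bp false, true, true => 1
  | .Bp true, false, false => X
  | .Bp true, true, false => X
  | .Bp true, false, true => -1
  | .Bp true, true, true => -1
  | .Bm false, false, false => -(X + 1)
  | .Bm false, true, false => 1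
  | .Bm false, false, true => -(X + 1)
  | .Bm false, true, true => 1
  | .Bm true, false, false => 0
  | .Bm true, true, false => 0
  | .Bm true, false, true => X + 1
  | .Bm true, true, true => -1

lemma aux_WJ (D : ChordDiagram n) :
    D.WJ = aux_Z (fun v w => (D.auxP v w : ℚ[X])) (fun v w => (D.auxQ v w : ℚ[X]))
      (fun t => (lsign t : ℚ[X])) auxC := by
  unfold WJ aux_Z
  refine Finset.sum_congr rfl fun ρ _ => Finset.prod_congr rfl fun v _ => ?_
  unfold omega
  rw [aux_kOf_l, aux_kOf_r]
  push_cast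
  generalize (∑ w, (D.auxP v w : ℚ[X]) * (lsign (ρ w) : ℚ[X])) = a
  generalize (∑ w, (D.auxQ v w : ℚ[X]) * (lsign (ρ w) : ℚ[X])) = b
  rcases ρ v with _ | ε | ε
  · simp [auxC]
  · cases ε <;> simp [auxC, lsign] <;> ring
  · cases ε <;> simp [auxC, lsign] <;> ring

/-- Numerical value of a Boolean. -/
noncomputable def auxB (b : Bool) : ℚ[X] := if b then 1 else 0

/-- Third row factor, times the Ryser sign. -/
noncomputable def auxW (x : Fin 3 → Bool) : ℚ[X] :=
  (∏ j, (if x j then (1 : ℚ[X]) else -1)) *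
    (X * auxB (x 0) + (-X - 2) * auxB (x 1) + auxB (x 2))

/-- Local weights of the permanent. -/
noncomputable def auxD (x : Fin 3 → Bool) : Bool → Bool → ℚ[X]
  | false, false => auxW x * ((X + 2) * auxB (x 0)) * ((X + 2) * auxB (x 1) + auxB (x 2))
  | true, false => auxW x * ((X + 2) * auxB (x 1) + auxB (x 2))
  | false, true => - auxW x * ((X + 2) * auxB (x 0))
  | true, true => - auxW x

lemma aux_IMJ_row (D : ChordDiagram n) (v w : Fin n) (x : Fin 3 → ℚ[X]) :
    (∑ j, D.IMJ (v, 0) (w, j) * x j = (if v = w then (X + 2) * x 0 else 0)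
      + (D.auxP v w : ℚ[X]) * (x 0 + x 1)) ∧
    (∑ j, D.IMJ (v, 1) (w, j) * x j = (if v = w then (X + 2) * x 1 + x 2 else 0)
      - (D.auxQ v w : ℚ[X]) * (x 0 + x 1)) ∧
    (∑ j, D.IMJ (v, 2) (w, j) * x j =
      (if v = w then X * x 0 + (-X - 2) * x 1 + x 2 else 0)) := by
  by_cases hvw : v = w
  · subst hvw
    simp [IMJ, A0, auxP, auxQ, Fin.sum_univ_three]
  · have hwv : w ≠ v := fun h => hvw h.symm
    have h1 := D.lr v
    have h2 := D.lr w
    have h3 := D.aux_l_ne_r v w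
    have h4 := D.aux_l_ne_r w v
    have h5 : D.r v ≠ D.r w := fun h => hvw (D.aux_r_inj h)
    have h6 : v < w ↔ D.l v < D.l w := D.mono.lt_iff_lt.symm
    have h7 : w < v ↔ D.l w < D.l v := D.mono.lt_iff_lt.symm
    have h8 : D.l v ≠ D.l w := fun h => hvw (D.mono.injective h)
    simp only [IMJ, if_neg hvw]
    by_cases hA : w < v ∧ D.Intersect v w
    · have hp : D.auxP v w = 1 := by unfold auxP; grind
      have hq : D.auxQ v w = 0 := by unfold auxQ; grind
      simp [hA, hp, hq, Aplus, Fin.sum_univ_three]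
    · by_cases hB : v < w ∧ D.Intersect v w
      · have hp : D.auxP v w = 0 := by unfold auxP; grind
        have hq : D.auxQ v w = 1 := by unfold auxQ; grind
        simp only [if_neg hA, if_pos hB, hp, hq]
        simp [Aminus, Fin.sum_univ_three]
        ring
      · by_cases hC : ¬ D.Intersect v w ∧ D.Contained v w
        · have hp : D.auxP v w = 1 := by unfold auxP; grind
          have hq : D.auxQ v w = 1 := by unfold auxQ; grind
          simp only [if_neg hA, if_neg hB, if_pos hC, hp, hq]
          simp [Acont, Fin.sum_univ_three]
          ring
        · have hp : D.auxP v w = 0 := by unfold auxP; grind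
          have hq : D.auxQ v w = 0 := by unfold auxQ; grind
          simp only [if_neg hA, if_neg hB, if_neg hC, hp, hq]
          simp

lemma aux_perm (D : ChordDiagram n) :
    perm D.IMJ = aux_Z (fun v w => (D.auxP v w : ℚ[X])) (fun v w => (D.auxQ v w : ℚ[X]))
      (fun x : Fin 3 → Bool => auxB (x 0) + auxB (x 1)) auxD := by
  rw [aux_ryser]
  unfold aux_Z
  refine Fintype.sum_equiv (Equiv.curry (Fin n) (Fin 3) Bool) _ _ fun x => ?_
  rw [Fintype.prod_prod_type, Fintype.prod_prod_type, ← Finset.prod_mul_distrib]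
  refine Finset.prod_congr rfl fun v _ => ?_
  rw [Fin.prod_univ_three (fun i => ∑ j, _)]
  simp_rw [Fintype.sum_prod_type]
  have hr := fun w => D.aux_IMJ_row v w (fun j => auxB (x (w, j)))
  have hb : ∀ b : Bool, (if b = true then (1 : ℚ[X]) else 0) = auxB b := fun _ => rfl
  simp_rw [hb]
  rw [Finset.sum_congr rfl fun w _ => (hr w).1, Finset.sum_congr rfl fun w _ => (hr w).2.1,
    Finset.sum_congr rfl fun w _ => (hr w).2.2]
  rw [Finset.sum_add_distrib, Finset.sum_sub_distrib]
  simp only [Finset.sum_ite_eq, Finset.mem_univ, if_true, Equiv.curry_apply, Function.curry_apply,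
    auxD, auxW]
  ring

lemma aux_sum_bool3 (f : (Fin 3 → Bool) → ℚ[X]) :
    ∑ x, f x = ∑ a : Bool, ∑ b : Bool, ∑ c : Bool, f ![a, b, c] := by
  rw [← (Fin.consEquiv (fun _ : Fin 3 => Bool)).sum_comp, Fintype.sum_prod_type]
  refine Finset.sum_congr rfl fun a _ => ?_
  rw [← (Fin.consEquiv (fun _ : Fin 2 => Bool)).sum_comp, Fintype.sum_prod_type]
  refine Finset.sum_congr rfl fun b _ => ?_
  rw [← (Fin.consEquiv (fun _ : Fin 1 => Bool)).sum_comp, Fintype.sum_prod_type]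
  refine Finset.sum_congr rfl fun c _ => ?_
  rw [Fintype.sum_unique]
  congr 1

lemma aux_sum_JCol (f : JCol → ℚ[X]) :
    ∑ x, f x = f .I + f (.Bp false) + f (.Bp true) + f (.Bm false) + f (.Bm true) := by
  have : (Finset.univ : Finset JCol) = {.I, .Bp false, .Bp true, .Bm false, .Bm true} := by
    decide
  rw [this]
  simp
  ring

/-- The leading moments. -/
noncomputable def auxLead : Bool → Bool → ℚ[X]
  | false, false => 0
  | true, false => X
  | false, true => - X - 2
  | true, true => -2

lemma aux_mom1 (e₁ e₂ : Bool) (d : ℕ) (hd : d ≤ e₁.toNat + e₂.toNat) :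
    aux_mom (fun t => (lsign t : ℚ[X])) auxC e₁ e₂ d
      = if d = e₁.toNat + e₂.toNat then auxLead e₁ e₂ else 0 := by
  unfold aux_mom
  rw [aux_sum_JCol]
  have hd2 : d ≤ 2 := by revert hd; cases e₁ <;> cases e₂ <;> simp <;> omega
  interval_cases d <;> cases e₁ <;> cases e₂ <;>
    first
      | (exfalso; revert hd; decide)
      | (simp [auxC, lsign, auxLead]; done)
      | (simp [auxC, lsign, auxLead]; ring)

lemma aux_mom2 (e₁ e₂ : Bool) (d : ℕ) (hd : d ≤ e₁.toNat + e₂.toNat) :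
    aux_mom (fun x : Fin 3 → Bool => auxB (x 0) + auxB (x 1)) auxD e₁ e₂ d
      = if d = e₁.toNat + e₂.toNat then auxLead e₁ e₂ else 0 := by
  unfold aux_mom
  rw [aux_sum_bool3]
  simp only [Fintype.sum_bool]
  have hd2 : d ≤ 2 := by revert hd; cases e₁ <;> cases e₂ <;> simp <;> omega
  interval_cases d <;> cases e₁ <;> cases e₂ <;>
    first
      | (exfalso; revert hd; decide)
      | (simp [auxD, auxW, auxB, auxLead, Fin.prod_univ_three]; done)
      | (simp [auxD, auxW, auxB, auxLead, Fin.prod_univ_three]; ring)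

end ChordDiagram

/-- **Theorem 1.** For every chord diagram `D`, the colored Jones weight system equals
the permanent of the blown-up intersection matrix: `W_J(D) = Per(IM_J(D))` in `ℚ[λ]`. -/
theorem WJ_eq_perm_IMJ {n : ℕ} (D : ChordDiagram n) :
    D.WJ = perm (ChordDiagram.IMJ D) := by
  rw [ChordDiagram.aux_WJ, ChordDiagram.aux_perm]
  refine aux_Z_congr _ _ _ _ _ _ ?_ ?_ ?_
  · intro e₁ e₂ d hd
    rw [ChordDiagram.aux_mom1 _ _ _ hd.le, if_neg hd.ne]
  · intro e₁ e₂ d hd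
    rw [ChordDiagram.aux_mom2 _ _ _ hd.le, if_neg hd.ne]
  · intro e₁ e₂
    rw [ChordDiagram.aux_mom1 _ _ _ le_rfl, ChordDiagram.aux_mom2 _ _ _ le_rfl]
end

section
/- For every chord diagram D, the colored Jones weight equals the partition function of its labeled intersection digraph with all variables set to 1: W_J(D) = J(LID(D))|_{x_e=1} in ℚ[λ]. -/
open Finset

variable {V : Type*} [Fintype V] [DecidableEq V]

/-! ### Proof -/

namespace JProof

open ChordDiagram LoopedDigraph

/-- The end of a thickened arc at which it is not thickened. -/
def oth {V : Type*} [Fintype V] [DecidableEq V] (G : LoopedDigraph V) (t : TArc V) : V :=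
  if t.1 ∈ G.red then t.1.2 else if t.2 then t.1.2 else t.1.1

/-- All admissible thickened arcs. -/
def allT {V : Type*} [Fintype V] [DecidableEq V] (G : LoopedDigraph V) : Finset (TArc V) :=
  univ.filter fun t => t.1 ∈ G.arcs ∧ (t.1.1 = t.1.2 → t.2 = true)

/-- Part of `K` thickened at `v` with flag `b`. -/
def part {V : Type*} [Fintype V] [DecidableEq V] (G : LoopedDigraph V) (K : Finset (TArc V))
    (p : V × Bool) : Finset (TArc V) := K.filter fun t => G.tvert t = p.1 ∧ t.2 = p.2

/-- Number of arcs of `K` whose non-thickened end is `v`. -/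
def mAt {V : Type*} [Fintype V] [DecidableEq V] (G : LoopedDigraph V) (K : Finset (TArc V))
    (v : V) : ℕ := (K.filter fun t => oth G t = v).card

/-- Coefficients of the two linear factors of the weight of a color. -/
noncomputable def ee : JCol → Bool → ℕ → Polynomial ℚ
  | .I, false, 0 => Polynomial.X + 2
  | .I, true, 0 => 1
  | .I, _, _ => 0
  | .Bp ε, false, 0 => - (-1 : Polynomial ℚ) ^ (if ε then 1 else 0)
  | .Bp ε, false, 1 => - (-1 : Polynomial ℚ) ^ (if ε then 1 else 0)
  | .Bp _, true, 0 => Polynomial.X + 1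
  | .Bp _, true, 1 => -1
  | .Bm _, false, 0 => Polynomial.X + 1
  | .Bm _, false, 1 => -1
  | .Bm ε, true, 0 => - (-1 : Polynomial ℚ) ^ (if ε then 1 else 0)
  | .Bm ε, true, 1 => - (-1 : Polynomial ℚ) ^ (if ε then 1 else 0)
  | _, _, _ => 0

lemma ee_big (c : JCol) (b : Bool) (m : ℕ) (hm : 2 ≤ m) : ee c b m = 0 := by
  obtain ⟨k, rfl⟩ : ∃ k, m = k + 2 := ⟨m - 2, by omega⟩
  cases c <;> cases b <;> rfl

/-- Local weight. -/
noncomputable def loc (p q m : ℕ) : Polynomial ℚ :=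
  ∑ c : JCol, ee c false p * ee c true q * ((lsign c : ℤ) : Polynomial ℚ) ^ m

lemma sum_JCol (f : JCol → Polynomial ℚ) :
    ∑ c : JCol, f c = f .I + (f (.Bp true) + f (.Bp false)) + (f (.Bm true) + f (.Bm false)) := by
  have : (univ : Finset JCol) = {.I, .Bp true, .Bp false, .Bm true, .Bm false} := by decide
  rw [this]
  simp [Finset.sum_insert]
  ring

lemma loc_big (p q m : ℕ) (h : 2 ≤ p ∨ 2 ≤ q) : loc p q m = 0 := by
  unfold loc
  apply Finset.sum_eq_zero
  intro c _
  rcases h with h | h <;> simp [ee_big _ _ _ h]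

lemma loc_00 : loc 0 0 0 = Polynomial.X + 2 := by
  simp [loc, sum_JCol, ee, lsign]

lemma loc_10 : loc 1 0 1 = Polynomial.X + 2 := by
  simp [loc, sum_JCol, ee, lsign]; ring

lemma loc_01 : loc 0 1 1 = -(Polynomial.X + 2) := by
  simp [loc, sum_JCol, ee, lsign]; ring

lemma loc_11 : loc 1 1 2 = -2 := by
  simp [loc, sum_JCol, ee, lsign]; ring

lemma loc_ne (p q m : ℕ) (h : loc p q m ≠ 0) : p ≤ 1 ∧ q ≤ 1 ∧ p + q ≤ m := by
  have hp : p ≤ 1 := by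
    by_contra hh; exact h (loc_big _ _ _ (by omega))
  have hq : q ≤ 1 := by
    by_contra hh; exact h (loc_big _ _ _ (by omega))
  refine ⟨hp, hq, ?_⟩
  by_contra hm
  apply h
  interval_cases p <;> interval_cases q
  · omega
  · obtain rfl : m = 0 := by omega
    simp [loc, sum_JCol, ee, lsign]
  · obtain rfl : m = 0 := by omega
    simp [loc, sum_JCol, ee, lsign]
  · have : m = 0 ∨ m = 1 := by omega
    rcases this with rfl | rfl <;> simp [loc, sum_JCol, ee, lsign]

lemma factor_expand {T : Type*} [DecidableEq T] (S : Finset T) (c : JCol) (b : Bool)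
    (x : T → Polynomial ℚ) :
    ee c b 0 + ee c b 1 * ∑ t ∈ S, x t = ∑ P ∈ S.powerset, ee c b P.card * ∏ t ∈ P, x t := by
  rw [Finset.sum_powerset]
  have h : ∀ j, ∑ P ∈ powersetCard j S, ee c b P.card * ∏ t ∈ P, x t =
      ee c b j * ∑ P ∈ powersetCard j S, ∏ t ∈ P, x t := by
    intro j
    rw [Finset.mul_sum]
    apply Finset.sum_congr rfl
    intro P hP
    rw [(Finset.mem_powersetCard.1 hP).2]
  rw [Finset.sum_congr rfl (fun j _ => h j)]
  have h2 : ∑ j ∈ range (S.card + 1), ee c b j * ∑ P ∈ powersetCard j S, ∏ t ∈ P, x t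
      = ∑ j ∈ range 2, ee c b j * ∑ P ∈ powersetCard j S, ∏ t ∈ P, x t := by
    rcases Nat.eq_zero_or_pos S.card with h0 | h0
    · rw [Finset.card_eq_zero] at h0
      subst h0
      simp [Finset.sum_range_succ, Finset.powersetCard_one]
    · symm
      apply Finset.sum_subset
      · intro j; simp; omega
      · intro j _ hj
        simp at hj
        simp [ee_big _ _ _ hj]
  rw [h2]
  simp [Finset.sum_range_succ, Finset.powersetCard_one]

variable {n : ℕ} (D : ChordDiagram n)

lemma kOf_eq (ρ : Fin n → JCol) (p : Fin (2 * n)) :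
    D.kOf ρ p = ∑ w ∈ univ.filter (fun w => D.l w < p ∧ p ≤ D.r w), lsign (ρ w) := by
  unfold kOf delta
  rw [Finset.sum_comm, Finset.sum_filter]
  apply Finset.sum_congr rfl
  intro w _
  rw [Finset.sum_add_distrib, Finset.sum_ite_eq, Finset.sum_ite_eq]
  have := D.lr w
  simp only [mem_filter, mem_univ, true_and]
  by_cases h1 : D.l w < p <;> by_cases h2 : D.r w < p
  · simp [h1, h2]
  · simp [h1, h2, not_lt.1 h2]
  · exact absurd (this.trans h2) h1
  · simp [h1, h2]

lemma l_ne_r (i j : Fin n) : D.l i ≠ D.r j := by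
  intro h
  obtain ⟨k, _, hk⟩ := D.cover (D.l i)
  have h1 := hk i (Or.inl rfl)
  have h2 := hk j (Or.inr h.symm)
  have := D.lr i
  rw [h1, ← h2, ← h, h1] at this
  rw [h2] at this
  exact lt_irrefl _ this

lemma r_inj (i j : Fin n) (h : D.r i = D.r j) : i = j := by
  obtain ⟨k, _, hk⟩ := D.cover (D.r i)
  rw [hk i (Or.inr rfl), hk j (Or.inr h.symm)]

lemma mem_red (e : Fin n × Fin n) : e ∈ (LID D).red ↔ D.Contained e.1 e.2 := by
  simp [LID]

lemma mem_arcs (e : Fin n × Fin n) : e ∈ (LID D).arcs ↔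
    (e.1 = e.2 ∨ (e.1 < e.2 ∧ D.Intersect e.1 e.2) ∨ D.Contained e.1 e.2) := by
  simp [LID]

lemma facts (v w : Fin n) : D.l v ≠ D.r w ∧ D.l w ≠ D.r v ∧ (D.r v = D.r w → v = w) ∧
    (v < w ↔ D.l v < D.l w) ∧ (w < v ↔ D.l w < D.l v) ∧ D.l v < D.r v ∧ D.l w < D.r w ∧
    (D.l v = D.l w → v = w) :=
  ⟨l_ne_r D v w, l_ne_r D w v, r_inj D v w, D.mono.lt_iff_lt.symm, D.mono.lt_iff_lt.symm,
    D.lr v, D.lr w, fun h => D.mono.injective h⟩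

lemma mem_A (v : Fin n) (t : TArc (Fin n)) :
    t ∈ part (LID D) (allT (LID D)) (v, false) ↔
      (t.2 = false ∧ ((t.1.1 = v ∧ D.Contained v t.1.2) ∨
        (t.1.2 = v ∧ D.l t.1.1 < D.l v ∧ D.l v < D.r t.1.1 ∧ D.r t.1.1 < D.r v))) := by
  obtain ⟨⟨a, b⟩, f⟩ := t
  have hf := facts D a b
  simp only [part, allT, mem_filter, mem_univ, true_and, mem_arcs, tvert, mem_red, Contained,
    Intersect]
  cases f
  · by_cases hc : D.l b < D.l a ∧ D.r a < D.r b
    · grind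
    · grind
  · simp

lemma mem_B (v : Fin n) (t : TArc (Fin n)) :
    t ∈ part (LID D) (allT (LID D)) (v, true) ↔
      (t.2 = true ∧ t.1.1 = v ∧ D.l t.1.2 < D.r v ∧ D.r v ≤ D.r t.1.2) := by
  obtain ⟨⟨a, b⟩, f⟩ := t
  have hf := facts D a b
  simp only [part, allT, mem_filter, mem_univ, true_and, mem_arcs, tvert, mem_red, Contained,
    Intersect]
  cases f
  · simp
  · grind

lemma kOf_l (ρ : Fin n → JCol) (v : Fin n) :
    D.kOf ρ (D.l v) = ∑ t ∈ part (LID D) (allT (LID D)) (v, false),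
      lsign (ρ (oth (LID D) t)) := by
  rw [kOf_eq]
  symm
  apply Finset.sum_nbij' (fun t => oth (LID D) t)
    (fun w => if D.Contained v w then ((v, w), false) else ((w, v), false))
  · rintro ⟨⟨a, b⟩, f⟩ ht
    have hf := facts D a b
    simp only [mem_A, Contained] at ht
    simp only [mem_filter, mem_univ, true_and, oth, mem_red, Contained]
    grind
  · intro w hw
    have hf := facts D v w
    simp only [mem_filter, mem_univ, true_and] at hw
    rw [mem_A]
    simp only [Contained]
    grind
  · rintro ⟨⟨a, b⟩, f⟩ ht
    have hf := facts D a b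
    simp only [mem_A, Contained] at ht
    simp only [oth, mem_red, Contained]
    grind
  · intro w hw
    have hf := facts D v w
    simp only [mem_filter, mem_univ, true_and] at hw
    simp only [oth, mem_red, Contained]
    grind
  · intros; rfl

lemma kOf_r (ρ : Fin n → JCol) (v : Fin n) :
    D.kOf ρ (D.r v) = ∑ t ∈ part (LID D) (allT (LID D)) (v, true),
      lsign (ρ (oth (LID D) t)) := by
  rw [kOf_eq]
  symm
  apply Finset.sum_nbij' (fun t => oth (LID D) t) (fun w => ((v, w), true))
  · rintro ⟨⟨a, b⟩, f⟩ ht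
    rw [mem_B] at ht
    simp only [mem_filter, mem_univ, true_and, oth]
    grind
  · intro w hw
    simp only [mem_filter, mem_univ, true_and] at hw
    rw [mem_B]
    grind
  · rintro ⟨⟨a, b⟩, f⟩ ht
    rw [mem_B] at ht
    simp only [oth]
    grind
  · intro w hw
    simp [oth]
  · intros; rfl

lemma omega_eq (ρ : Fin n → JCol) (v : Fin n) :
    D.omega ρ v = ∏ b : Bool, ∑ P ∈ (part (LID D) (allT (LID D)) (v, b)).powerset,
      ee (ρ v) b P.card * ∏ t ∈ P, ((lsign (ρ (oth (LID D) t)) : ℤ) : Polynomial ℚ) := by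
  simp only [← factor_expand, Fintype.prod_bool]
  have h1 := congrArg (Int.cast : ℤ → Polynomial ℚ) (kOf_l D ρ v)
  have h2 := congrArg (Int.cast : ℤ → Polynomial ℚ) (kOf_r D ρ v)
  rw [Int.cast_sum] at h1 h2
  rw [← h1, ← h2]
  unfold omega
  rcases ρ v with _ | ε | ε
  · simp [ee]
  · cases ε <;> simp only [ee] <;> ring
  · cases ε <;> simp only [ee] <;> ring

lemma WJ_eq_sum : D.WJ = ∑ K ∈ (allT (LID D)).powerset,
    ∏ v, loc (part (LID D) K (v, false)).card (part (LID D) K (v, true)).card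
      (mAt (LID D) K v) := by
  set G := LID D with hG
  have hterm : ∀ K ∈ (allT G).powerset,
      ∏ v, loc (part G K (v, false)).card (part G K (v, true)).card (mAt G K v)
      = ∑ ρ : Fin n → JCol, ∏ p : Fin n × Bool, (ee (ρ p.1) p.2 (part G K p).card *
          ∏ t ∈ part G K p, ((lsign (ρ (oth G t)) : ℤ) : Polynomial ℚ)) := by
    intro K _
    unfold loc
    rw [Finset.prod_univ_sum, Fintype.piFinset_univ]
    apply Finset.sum_congr rfl
    intro ρ _
    rw [Finset.prod_mul_distrib]
    conv_rhs => rw [Finset.prod_mul_distrib]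
    congr 1
    · rw [Fintype.prod_prod_type]
      apply Finset.prod_congr rfl
      intro v _
      rw [Fintype.prod_bool, mul_comm]
    · have e1 : ∏ p : Fin n × Bool, ∏ t ∈ part G K p,
          ((lsign (ρ (oth G t)) : ℤ) : Polynomial ℚ)
          = ∏ t ∈ K, ((lsign (ρ (oth G t)) : ℤ) : Polynomial ℚ) := by
        rw [← Finset.prod_fiberwise K (fun t => (G.tvert t, t.2))]
        apply Finset.prod_congr rfl
        intro p _
        unfold part
        simp [Prod.ext_iff]
      rw [e1, ← Finset.prod_fiberwise K (fun t => oth G t)]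
      apply Finset.prod_congr rfl
      intro v _
      unfold mAt
      rw [← Finset.prod_const]
      apply Finset.prod_congr rfl
      intro t ht
      rw [(Finset.mem_filter.1 ht).2]
  rw [Finset.sum_congr rfl hterm, Finset.sum_comm]
  unfold WJ
  apply Finset.sum_congr rfl
  intro ρ _
  have h1 : ∏ v, D.omega ρ v = ∏ p : Fin n × Bool, ∑ P ∈ (part G (allT G) p).powerset,
      ee (ρ p.1) p.2 P.card * ∏ t ∈ P, ((lsign (ρ (oth G t)) : ℤ) : Polynomial ℚ) := by
    rw [Fintype.prod_prod_type]
    exact Finset.prod_congr rfl (fun v _ => omega_eq D ρ v)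
  rw [h1, Finset.prod_univ_sum]
  symm
  apply Finset.sum_nbij' (fun K => part G K) (fun P => univ.biUnion P)
  · intro K hK
    rw [Fintype.mem_piFinset]
    intro p
    rw [Finset.mem_powerset] at hK ⊢
    exact Finset.filter_subset_filter _ hK
  · intro P hP
    rw [Fintype.mem_piFinset] at hP
    rw [Finset.mem_powerset]
    intro t ht
    obtain ⟨p, _, hp⟩ := Finset.mem_biUnion.1 ht
    exact (Finset.mem_filter.1 (Finset.mem_powerset.1 (hP p) hp)).1
  · intro K _
    ext t
    simp [part]
  · intro P hP
    rw [Fintype.mem_piFinset] at hP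
    funext p
    ext t
    simp only [part, mem_filter, mem_biUnion, mem_univ, true_and]
    constructor
    · rintro ⟨⟨q, hq⟩, h1, h2⟩
      have := (Finset.mem_filter.1 (Finset.mem_powerset.1 (hP q) hq)).2
      have : q = p := by ext1 <;> simp [← this.1, ← this.2, h1, h2]
      rwa [← this]
    · intro h
      exact ⟨⟨p, h⟩, (Finset.mem_filter.1 (Finset.mem_powerset.1 (hP p) h)).2⟩
  · intro K _
    rfl

section combinatorics

variable {V : Type*} [Fintype V] [DecidableEq V] (G : LoopedDigraph V)

lemma degAt_eq (K : Finset (TArc V)) (v : V) : degAt K v = G.thickAt K v + mAt G K v := by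
  unfold degAt thickAt mAt
  rw [Finset.card_filter, Finset.card_filter, ← Finset.sum_add_distrib]
  apply Finset.sum_congr rfl
  intro t _
  unfold tvert oth
  split_ifs <;> simp_all

lemma thickAt_eq (K : Finset (TArc V)) (v : V) :
    G.thickAt K v = (part G K (v, false)).card + (part G K (v, true)).card := by
  unfold thickAt part
  simp only [Finset.card_filter]
  rw [← Finset.sum_add_distrib]
  apply Finset.sum_congr rfl
  rintro ⟨e, b⟩ _
  cases b <;> simp

lemma src_iff (t : TArc V) (ht : t ∈ allT G) : G.src t = G.tvert t ↔ t.2 = true := by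
  obtain ⟨⟨a, b⟩, f⟩ := t
  simp only [allT, mem_filter, mem_univ, true_and] at ht
  unfold src tvert
  cases f
  · by_cases h : (a, b) ∈ G.red
    · simp_all [eq_comm]
    · simp_all
  · simp

lemma outThickAt_eq (K : Finset (TArc V)) (hK : K ⊆ allT G) (v : V) :
    G.outThickAt K v = (part G K (v, true)).card := by
  unfold outThickAt part
  congr 1
  apply Finset.filter_congr
  intro t ht
  rw [← src_iff G t (hK ht)]
  constructor
  · rintro ⟨h1, h2⟩; exact ⟨h1, h2.trans h1.symm⟩
  · rintro ⟨h1, h2⟩; exact ⟨h1, h2.trans h1⟩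

lemma aK_eq (K : Finset (TArc V)) (hK : K ⊆ allT G) :
    G.aK K = ∑ v, (part G K (v, true)).card := by
  unfold aK
  rw [Finset.filter_congr (fun t ht => src_iff G t (hK ht)),
    Finset.card_eq_sum_card_fiberwise (f := G.tvert) (t := univ) (by intro _ _; simp)]
  apply Finset.sum_congr rfl
  intro v _
  unfold part
  rw [Finset.filter_filter]
  congr 1
  apply Finset.filter_congr
  intro t _
  exact and_comm

lemma sum_thick (K : Finset (TArc V)) : ∑ v, G.thickAt K v = ∑ v, mAt G K v := by
  unfold thickAt mAt
  rw [← Finset.card_eq_sum_card_fiberwise (f := G.tvert) (t := univ) (by intro _ _; simp),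
    ← Finset.card_eq_sum_card_fiberwise (f := oth G) (t := univ) (by intro _ _; simp)]

lemma term_acc (K : Finset (TArc V)) (h : G.IsAcceptable K) (hK : K ⊆ allT G) :
    ∏ v, loc (part G K (v, false)).card (part G K (v, true)).card (mAt G K v) =
      2 ^ deg4 K * (Polynomial.X + 2) ^ (Fintype.card V - deg4 K) *
        (∏ t ∈ K, (1 : Polynomial ℚ)) * (-1) ^ G.aK K := by
  have key : ∀ v, loc (part G K (v, false)).card (part G K (v, true)).card (mAt G K v) =
      (if degAt K v = 4 then 2 else Polynomial.X + 2) *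
        (-1) ^ (part G K (v, true)).card := by
    intro v
    have h1 := degAt_eq G K v
    have h2 := thickAt_eq G K v
    have h3 := outThickAt_eq G K hK v
    have h4 := h.deg024 v
    have h5 := h.half_thick v
    have h6 := h.balance v
    generalize (part G K (v, false)).card = p at *
    generalize (part G K (v, true)).card = q at *
    have : (p = 0 ∧ q = 0 ∧ mAt G K v = 0 ∧ degAt K v = 0) ∨
        (p = 1 ∧ q = 0 ∧ mAt G K v = 1 ∧ degAt K v = 2) ∨
        (p = 0 ∧ q = 1 ∧ mAt G K v = 1 ∧ degAt K v = 2) ∨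
        (p = 1 ∧ q = 1 ∧ mAt G K v = 2 ∧ degAt K v = 4) := by omega
    rcases this with ⟨rfl, rfl, h7, h8⟩ | ⟨rfl, rfl, h7, h8⟩ | ⟨rfl, rfl, h7, h8⟩ |
      ⟨rfl, rfl, h7, h8⟩
    · rw [h7, h8, loc_00]; simp
    · rw [h7, h8, loc_10]; simp
    · rw [h7, h8, loc_01]; simp
    · rw [h7, h8, loc_11]; simp
  rw [Finset.prod_congr rfl (fun v _ => key v), Finset.prod_mul_distrib,
    Finset.prod_pow_eq_pow_sum, ← aK_eq G K hK, Finset.prod_ite, Finset.prod_const,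
    Finset.prod_const, Finset.prod_const_one, mul_one]
  have : (univ.filter fun v => ¬ degAt K v = 4).card = Fintype.card V - deg4 K := by
    rw [← Finset.compl_filter, Finset.card_compl]; rfl
  rw [this]
  rfl

lemma term_nacc (K : Finset (TArc V)) (h : ¬ G.IsAcceptable K) (hK : K ⊆ allT G) :
    ∏ v, loc (part G K (v, false)).card (part G K (v, true)).card (mAt G K v) = 0 := by
  by_contra hne
  rw [← ne_eq, Finset.prod_ne_zero_iff] at hne
  have hl := fun v => loc_ne _ _ _ (hne v (mem_univ v))
  have hle : ∀ v ∈ univ, G.thickAt K v ≤ mAt G K v := by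
    intro v _
    rw [thickAt_eq]
    exact (hl v).2.2
  have heq := (Finset.sum_eq_sum_iff_of_le hle).1 (sum_thick G K)
  apply h
  refine ⟨?_, ?_, ?_, ?_, ?_⟩
  · intro t ht
    exact (Finset.mem_filter.1 (hK ht)).2.1
  · intro t ht
    exact (Finset.mem_filter.1 (hK ht)).2.2
  all_goals
    intro v
    have h1 := degAt_eq G K v
    have h2 := thickAt_eq G K v
    have h3 := outThickAt_eq G K hK v
    have h4 := hl v
    have h5 := heq v (mem_univ v)
    omega

end combinatorics

end JProof

/-- **Theorem 2.** For every chord diagram `D`, the colored Jones weight equals the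
partition function of its labeled intersection digraph with all variables set to `1`:
`W_J(D) = J(LID(D))|_{x_e=1}` in `ℚ[λ]`. -/
theorem WJ_eq_J_LID {n : ℕ} (D : ChordDiagram n) :
    D.WJ = (LID D).J Polynomial.X (fun _ => 1) := by
  classical
  rw [JProof.WJ_eq_sum]
  unfold LoopedDigraph.J
  rw [← Finset.sum_subset (Finset.subset_univ (JProof.allT (LID D)).powerset)]
  · apply Finset.sum_congr rfl
    intro K hK
    rw [Finset.mem_powerset] at hK
    split_ifs with h
    · rw [JProof.term_acc _ K h hK]
    · exact JProof.term_nacc _ K h hK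
  · intro K _ hK
    rw [if_neg]
    intro h
    apply hK
    rw [Finset.mem_powerset]
    intro t ht
    exact Finset.mem_filter.2 ⟨mem_univ _, h.mem_arcs t ht, h.loop_thick t ht⟩
end

section
/- For every chord diagram D, the partition function of its labeled intersection digraph evaluated at all variables equal to 1 equals the permanent of the blown-up intersection matrix: J(LID(D))|_{x_e=1} = Per(IM_J(D)) in ℚ[λ]. -/
open Finset

variable {V : Type*} [Fintype V] [DecidableEq V]

/-! ### Permanent side -/

section PermSide

variable {W R : Type*} [Fintype W] [DecidableEq W] [CommRing R]

open Classical in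
/-- Sum over bijective functions of products of entries. -/
noncomputable def bsum {α β : Type*} [Fintype α] [Fintype β] [DecidableEq α]
    (m : α → β → R) : R :=
  ∑ k : α → β, if Function.Bijective k then ∏ r, m r (k r) else 0

open Classical in
theorem perm_eq_bsum {ι : Type*} [Fintype ι] [DecidableEq ι] (M : Matrix ι ι R) :
    perm M = bsum (fun i j => M i j) := by
  unfold perm bsum
  have h2 := Finset.sum_filter (s := univ) (fun k : ι → ι => Function.Bijective k)
    (fun k => ∏ r, M r (k r))
  refine Eq.trans (Eq.trans ?_ h2) (Finset.sum_congr rfl fun k _ => by congr)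
  refine Finset.sum_bij (fun σ _ => (σ : ι → ι)) ?_ ?_ ?_ ?_
  · intro σ _
    simpa using σ.bijective
  · intro σ _ σ' _ h
    exact DFunLike.coe_injective h
  · intro g hg
    simp only [mem_filter, mem_univ, true_and] at hg
    exact ⟨Equiv.ofBijective g hg, mem_univ _, rfl⟩
  · intro σ _
    rfl

theorem bijective_pair_iff {ι C : Type*} (τ : ι → W) (k : ι → C) :
    Function.Bijective (fun r => (τ r, k r)) ↔
      ∀ u, Function.Bijective (fun r : {r // τ r = u} => k r.1) := by
  constructor
  · intro h u
    constructor
    · rintro ⟨r, hr⟩ ⟨r', hr'⟩ e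
      apply Subtype.ext
      apply h.1
      simp only at e
      simp [hr, hr', e]
    · intro c
      obtain ⟨r, hr⟩ := h.2 (u, c)
      simp only [Prod.mk.injEq] at hr
      exact ⟨⟨r, hr.1⟩, hr.2⟩
  · intro h
    constructor
    · intro r r' e
      simp only [Prod.mk.injEq] at e
      have := @(h (τ r')).1 ⟨r, e.1⟩ ⟨r', rfl⟩ e.2
      simpa using this
    · rintro ⟨u, c⟩
      obtain ⟨⟨r, hr⟩, hc⟩ := (h u).2 c
      exact ⟨r, by simp [hr, ← hc]⟩

/-- A permanent with columns `W × C`, grouped by the block of the column. -/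
theorem bsum_fiber {ι C : Type*} [Fintype ι] [DecidableEq ι] [Fintype C]
    (M : ι → W × C → R) :
    bsum M = ∑ τ : ι → W, ∏ u, bsum (fun (r : {r // τ r = u}) (c : C) => M r.1 (u, c)) := by
  classical
  unfold bsum
  rw [← (Equiv.arrowProdEquivProdArrow ι (fun _ => W) (fun _ => C)).symm.sum_comp,
    Fintype.sum_prod_type]
  refine Finset.sum_congr rfl fun τ _ => ?_
  rw [Finset.prod_univ_sum]
  rw [Fintype.piFinset_univ]
  let e : (ι → C) ≃ ((u : W) → {r // τ r = u} → C) :=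
    { toFun := fun k u r => k r.1
      invFun := fun k r => k (τ r) ⟨r, rfl⟩
      left_inv := fun k => rfl
      right_inv := fun k => by
        funext u r
        obtain ⟨r, rfl⟩ := r
        rfl }
  rw [← e.sum_comp]
  refine Finset.sum_congr rfl fun k _ => ?_
  have h1 : Function.Bijective ((Equiv.arrowProdEquivProdArrow ι (fun _ => W)
      (fun _ => C)).symm (τ, k)) ↔
      ∀ u, Function.Bijective (fun r : {r // τ r = u} => k r.1) := bijective_pair_iff τ k
  by_cases hb : ∀ u, Function.Bijective (fun r : {r // τ r = u} => k r.1)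
  · rw [if_pos (h1.2 hb)]
    have : ∀ u, (if Function.Bijective (e k u) then
        ∏ r : {r // τ r = u}, M r.1 (u, e k u r) else 0) =
        ∏ r : {r // τ r = u}, M r.1 (τ r.1, k r.1) := by
      intro u
      refine (if_pos (hb u)).trans ?_
      refine Finset.prod_congr rfl fun r _ => ?_
      rw [r.2]
      rfl
    rw [Finset.prod_congr rfl fun u _ => this u]
    exact (Fintype.prod_fiberwise τ (fun r => M r (τ r, k r))).symm
  · rw [if_neg (fun h => hb (h1.1 h))]
    push Not at hb
    obtain ⟨u, hu⟩ := hb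
    exact (Finset.prod_eq_zero (mem_univ u) (if_neg hu)).symm

theorem bsum_equiv {α α' β : Type*} [Fintype α] [Fintype β] [DecidableEq α] [Fintype α']
    [DecidableEq α'] (e : α' ≃ α) (m : α → β → R) :
    bsum m = bsum (fun a b => m (e a) b) := by
  classical
  unfold bsum
  rw [← (e.arrowCongr (Equiv.refl β)).sum_comp]
  refine Finset.sum_congr rfl fun k _ => ?_
  have : Function.Bijective ((e.arrowCongr (Equiv.refl β)) k) ↔ Function.Bijective k := by
    exact Function.Bijective.of_comp_iff k e.symm.bijective
  simp only [this]
  rw [← e.prod_comp]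
  simp

theorem bsum_fin3 (m : Fin 3 → Fin 3 → R) :
    bsum m = m 0 0 * m 1 1 * m 2 2 + m 0 0 * m 1 2 * m 2 1 + m 0 1 * m 1 0 * m 2 2
      + m 0 1 * m 1 2 * m 2 0 + m 0 2 * m 1 0 * m 2 1 + m 0 2 * m 1 1 * m 2 0 := by
  classical
  have h : (univ.filter fun k : Fin 3 → Fin 3 => Function.Bijective k) =
      {![0, 1, 2], ![0, 2, 1], ![1, 0, 2], ![1, 2, 0], ![2, 0, 1], ![2, 1, 0]} := by
    ext k
    rw [mem_filter]
    simp only [mem_univ, true_and]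
    revert k
    decide
  unfold bsum
  have h2 := Finset.sum_filter (s := univ) (fun k : Fin 3 → Fin 3 => Function.Bijective k)
    (fun k => ∏ r, m r (k r))
  refine Eq.trans ?_ (h2.symm.trans ?_)
  · refine Finset.sum_congr rfl fun k _ => ?_
    congr
  rw [h]
  rw [Finset.sum_insert (by decide), Finset.sum_insert (by decide), Finset.sum_insert (by decide),
    Finset.sum_insert (by decide), Finset.sum_insert (by decide), Finset.sum_singleton]
  simp only [Fin.prod_univ_three]
  simp
  ring

theorem bsum_eq_zero_of_card {α β : Type*} [Fintype α] [Fintype β] [DecidableEq α]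
    (m : α → β → R) (h : Fintype.card α ≠ Fintype.card β) : bsum m = 0 := by
  unfold bsum
  refine Finset.sum_eq_zero fun k _ => if_neg fun hk => h (Fintype.card_of_bijective hk)

theorem bsum_eq_zero_of_row {α β : Type*} [Fintype α] [Fintype β] [DecidableEq α]
    (m : α → β → R) (a : α) (h : ∀ b, m a b = 0) : bsum m = 0 := by
  unfold bsum
  refine Finset.sum_eq_zero fun k _ => ?_
  split_ifs
  · exact Finset.prod_eq_zero (mem_univ a) (h _)
  · rfl

theorem bsum_smul {α β : Type*} [Fintype α] [Fintype β] [DecidableEq α]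
    (c : α → R) (m : α → β → R) :
    bsum (fun a b => c a * m a b) = (∏ a, c a) * bsum m := by
  unfold bsum
  rw [Finset.mul_sum]
  refine Finset.sum_congr rfl fun k _ => ?_
  split_ifs
  · rw [Finset.prod_mul_distrib]
  · simp

theorem bsum_three {ι : Type*} [Fintype ι] [DecidableEq ι] (p : ι → Prop) [DecidablePred p]
    (x y z : ι) (hxy : x ≠ y) (hxz : x ≠ z) (hyz : y ≠ z)
    (hp : ∀ r, p r ↔ r = x ∨ r = y ∨ r = z) (m : ι → Fin 3 → R) :
    bsum (fun (r : {r // p r}) c => m r.1 c) =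
      m x 0 * m y 1 * m z 2 + m x 0 * m y 2 * m z 1 + m x 1 * m y 0 * m z 2
      + m x 1 * m y 2 * m z 0 + m x 2 * m y 0 * m z 1 + m x 2 * m y 1 * m z 0 := by
  let f : Fin 3 → {r // p r} := ![⟨x, by simp [hp]⟩, ⟨y, by simp [hp]⟩, ⟨z, by simp [hp]⟩]
  have hf : Function.Bijective f := by
    constructor
    · intro a b
      fin_cases a <;> fin_cases b <;> simp [f, hxy, hxz, hyz, hxy.symm, hxz.symm, hyz.symm]
    · rintro ⟨r, hr⟩
      rcases (hp r).1 hr with rfl | rfl | rfl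
      · exact ⟨0, rfl⟩
      · exact ⟨1, rfl⟩
      · exact ⟨2, rfl⟩
  rw [bsum_equiv (Equiv.ofBijective f hf), bsum_fin3]
  rfl

end PermSide
section IMJSide

open ChordDiagram

variable {n : ℕ}

/-- Allowed arcs thickened at `v` and entering `v` from `w`. -/
def ain (D : ChordDiagram n) (v w : Fin n) : Prop :=
  (w < v ∧ D.Intersect v w) ∨ D.Contained v w

/-- Allowed non-loop arcs thickened at `v` and leaving `v` towards `w`. -/
def aout (D : ChordDiagram n) (v w : Fin n) : Prop :=
  (v < w ∧ D.Intersect v w) ∨ D.Contained v w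

instance (D : ChordDiagram n) (v w : Fin n) : Decidable (ain D v w) := by
  unfold ain; infer_instance

instance (D : ChordDiagram n) (v w : Fin n) : Decidable (aout D v w) := by
  unfold aout; infer_instance

theorem not_int_of_cont (D : ChordDiagram n) {v w : Fin n} (h : D.Contained v w) :
    ¬ D.Intersect v w := by
  obtain ⟨h1, h2⟩ := h
  rintro (⟨a, b, c⟩ | ⟨a, b, c⟩)
  · exact lt_asymm h1 a
  · exact lt_asymm h2 c

theorem int_symm (D : ChordDiagram n) {v w : Fin n} (h : D.Intersect v w) :
    D.Intersect w v := Or.symm h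

theorem cont_ne (D : ChordDiagram n) {v w : Fin n} (h : D.Contained v w) : v ≠ w := by
  rintro rfl
  exact lt_irrefl _ h.1

theorem ain_ne (D : ChordDiagram n) {v w : Fin n} (h : ain D v w) : v ≠ w := by
  rcases h with h | h
  · exact h.1.ne'
  · exact cont_ne D h

theorem aout_ne (D : ChordDiagram n) {v w : Fin n} (h : aout D v w) : v ≠ w := by
  rcases h with h | h
  · exact h.1.ne
  · exact cont_ne D h

/-- The coefficient of row `r` in block `u`. -/
noncomputable def coef (D : ChordDiagram n) (r : Fin n × Fin 3) (u : Fin n) : Polynomial ℚ :=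
  if r.1 = u then 1
  else if r.2 = 0 then (if ain D r.1 u then 1 else 0)
  else if r.2 = 1 then (if aout D r.1 u then -1 else 0) else 0

/-- The normalized row `r` in block `u`. -/
noncomputable def mrow (r : Fin n × Fin 3) (u : Fin n) (c : Fin 3) : Polynomial ℚ :=
  if r.1 = u then A0 r.2 c else if c = 2 then 0 else 1

theorem IMJ_eq (D : ChordDiagram n) (r : Fin n × Fin 3) (u : Fin n) (c : Fin 3) :
    IMJ D r (u, c) = coef D r u * mrow r u c := by
  obtain ⟨v, k⟩ := r
  unfold IMJ coef mrow
  simp only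
  by_cases h : v = u
  · simp [h]
  · simp only [h, if_false]
    by_cases hi : D.Intersect v u
    · have hc : ¬ D.Contained v u := fun hc => not_int_of_cont D hc hi
      have e1 : ain D v u ↔ u < v := by simp only [ain, hi, hc, and_true, or_false]
      have e2 : aout D v u ↔ v < u := by simp only [aout, hi, hc, and_true, or_false]
      simp only [e1, e2, hi, and_true]
      rcases lt_or_gt_of_ne h with hl | hl
      · simp only [hl, if_true, not_lt_of_gt hl, if_false]
        fin_cases k <;> fin_cases c <;> simp [Aminus]
      · simp only [hl, if_true, not_lt_of_gt hl, if_false]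
        fin_cases k <;> fin_cases c <;> simp [Aplus]
    · have e1 : ain D v u ↔ D.Contained v u := by
        simp only [ain, hi, and_false, false_or]
      have e2 : aout D v u ↔ D.Contained v u := by
        simp only [aout, hi, and_false, false_or]
      simp only [e1, e2, hi, and_false, if_false, not_false_eq_true, true_and]
      by_cases hc : D.Contained v u
      · simp only [eq_true hc, if_true]
        fin_cases k <;> fin_cases c <;> simp [Acont]
      · simp only [hc, if_false]
        fin_cases k <;> simp

/-- The local weight. -/
noncomputable def qv (v a b : Fin n) : Polynomial ℚ :=
  if a = v then (if b = v then 0 else Polynomial.X + 2)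
  else if b = v then Polynomial.X else 2

/-- The local factor at `v`. -/
noncomputable def Qv (D : ChordDiagram n) (v a b : Fin n) : Polynomial ℚ :=
  coef D (v, 0) a * coef D (v, 1) b * qv v a b

/-- The extension of a pair of targets per vertex to all three rows. -/
def tauOf (t : Fin n → Fin n × Fin n) (r : Fin n × Fin 3) : Fin n :=
  if r.2 = 0 then (t r.1).1 else if r.2 = 1 then (t r.1).2 else r.1

/-- Number of incoming targets at `u`. -/
def inCount (t : Fin n → Fin n × Fin n) (u : Fin n) : ℕ :=
  (univ.filter fun v => (t v).1 = u).card + (univ.filter fun v => (t v).2 = u).card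

theorem card_fiber_tauOf (t : Fin n → Fin n × Fin n) (u : Fin n) :
    Fintype.card {r // tauOf t r = u} = inCount t u + 1 := by
  rw [Fintype.card_subtype, Finset.card_filter, Fintype.sum_prod_type]
  simp only [Fin.sum_univ_three, tauOf]
  simp [Finset.sum_add_distrib, inCount]

theorem bsum_mrow (t : Fin n → Fin n × Fin n) (u : Fin n) (h : inCount t u = 2) :
    bsum (fun (r : {r // tauOf t r = u}) (c : Fin 3) => mrow r.1 u c) =
      qv u (t u).1 (t u).2 := by
  have hc := card_fiber_tauOf t u
  rw [h, Fintype.card_subtype] at hc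
  have hz : (u, (2 : Fin 3)) ∈ univ.filter fun r => tauOf t r = u := by
    rw [mem_filter]; simp [tauOf]
  rw [← Finset.card_erase_add_one hz] at hc
  obtain ⟨x, y, hxy, he⟩ := Finset.card_eq_two.1 (Nat.succ_injective hc)
  have hmem : ∀ r, tauOf t r = u ↔ r = x ∨ r = y ∨ r = (u, 2) := by
    intro r
    have h1 : r ∈ (univ.filter fun r => tauOf t r = u).erase (u, 2) ↔ r = x ∨ r = y := by
      rw [he]; simp
    simp only [mem_erase, mem_filter, mem_univ, true_and] at h1
    by_cases hr : r = (u, 2)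
    · subst hr; simp [tauOf]
    · simp only [hr, or_false, ← h1]; simp [hr]
  have hxz : x ≠ (u, 2) := by
    have : x ∈ (univ.filter fun r => tauOf t r = u).erase (u, 2) := by rw [he]; simp
    exact (mem_erase.1 this).1
  have hyz : y ≠ (u, 2) := by
    have : y ∈ (univ.filter fun r => tauOf t r = u).erase (u, 2) := by rw [he]; simp
    exact (mem_erase.1 this).1
  rw [bsum_three (fun r => tauOf t r = u) x y (u, 2) hxy hxz hyz hmem
    (fun r c => mrow r u c)]
  have h0 : (t u).1 = u ↔ (u, 0) = x ∨ (u, 0) = y := by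
    have := hmem (u, 0)
    simpa [tauOf] using this
  have h1 : (t u).2 = u ↔ (u, 1) = x ∨ (u, 1) = y := by
    have := hmem (u, 1)
    simpa [tauOf] using this
  obtain ⟨x1, x2⟩ := x
  obtain ⟨y1, y2⟩ := y
  unfold qv
  simp only [h0, h1, mrow]
  clear hmem h0 h1 he hz hc
  by_cases hx : x1 = u <;> by_cases hy : y1 = u
  · subst hx; subst hy
    fin_cases x2 <;> fin_cases y2 <;> simp [A0] at hxy hxz hyz ⊢ <;> ring
  · subst hx
    fin_cases x2 <;> simp [A0, hy, Ne.symm hy] at hxy hxz hyz ⊢ <;> ring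
  · subst hy
    fin_cases y2 <;> simp [A0, hx, Ne.symm hx] at hxy hxz hyz ⊢ <;> ring
  · simp [A0, hx, hy, Ne.symm hx, Ne.symm hy]
    ring

theorem perm_IMJ_eq (D : ChordDiagram n) :
    perm (IMJ D) = ∑ t : Fin n → Fin n × Fin n,
      if (∀ u, inCount t u = 2) then ∏ v, Qv D v (t v).1 (t v).2 else 0 := by
  classical
  rw [perm_eq_bsum, bsum_fiber]
  symm
  refine Finset.sum_of_injOn tauOf ?_ ?_ ?_ ?_
  · intro t _ t' _ h
    funext v
    have h0 := congrFun h (v, 0)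
    have h1 := congrFun h (v, 1)
    simp [tauOf] at h0 h1
    exact Prod.ext h0 h1
  · intro t _
    simp
  · intro τ _ hτ
    have : ∃ v, τ (v, 2) ≠ v := by
      by_contra hcon
      push Not at hcon
      apply hτ
      refine ⟨fun v => (τ (v, 0), τ (v, 1)), by simp, ?_⟩
      funext r
      obtain ⟨v, k⟩ := r
      fin_cases k <;> simp [tauOf, hcon]
    obtain ⟨v, hv⟩ := this
    refine Finset.prod_eq_zero (mem_univ (τ (v, 2))) ?_
    refine bsum_eq_zero_of_row _ ⟨(v, 2), rfl⟩ fun c => ?_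
    rw [IMJ_eq]
    simp [coef, Ne.symm hv]
  · intro t _
    simp only [IMJ_eq]
    have e : ∀ u, bsum (fun (r : {r // tauOf t r = u}) (c : Fin 3) =>
        coef D r.1 u * mrow r.1 u c) = (∏ r : {r // tauOf t r = u}, coef D r.1 (tauOf t r.1)) *
        bsum (fun (r : {r // tauOf t r = u}) (c : Fin 3) => mrow r.1 u c) := by
      intro u
      rw [bsum_smul (fun r : {r // tauOf t r = u} => coef D r.1 u)]
      congr 1
      refine Finset.prod_congr rfl fun r _ => ?_
      rw [r.2]
    rw [Finset.prod_congr rfl fun u _ => e u]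
    split_ifs with h
    · rw [Finset.prod_mul_distrib, Fintype.prod_fiberwise (tauOf t)
        (fun r => coef D r (tauOf t r)), Finset.prod_congr rfl fun u _ => bsum_mrow t u (h u),
        Fintype.prod_prod_type, ← Finset.prod_mul_distrib]
      refine Finset.prod_congr rfl fun v _ => ?_
      simp only [Fin.prod_univ_three, Qv]
      simp [tauOf, coef]
    · push Not at h
      obtain ⟨u, hu⟩ := h
      symm
      refine Finset.prod_eq_zero (mem_univ u) ?_
      rw [bsum_eq_zero_of_card _ (by rw [card_fiber_tauOf]; simpa using hu), mul_zero]

end IMJSide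
section JSide

open ChordDiagram LoopedDigraph

variable {n : ℕ}

/-- The thickened arc thickened at `v` and entering `v` from `w`. -/
def encIn (D : ChordDiagram n) (v w : Fin n) : TArc (Fin n) :=
  if D.Contained v w then ((v, w), false) else ((w, v), false)

/-- The thickened arc thickened at `v` and leaving `v` towards `w`. -/
def encOut (v w : Fin n) : TArc (Fin n) := ((v, w), true)

theorem mem_red (D : ChordDiagram n) (v w : Fin n) :
    (v, w) ∈ (LID D).red ↔ D.Contained v w := by
  simp [LID]

theorem mem_arcs' (D : ChordDiagram n) (v w : Fin n) :
    (v, w) ∈ (LID D).arcs ↔ v = w ∨ aout D v w := by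
  simp [LID, aout]

theorem not_cont_of_ain (D : ChordDiagram n) {v w : Fin n} (h : ain D v w)
    (hc : ¬ D.Contained v w) : ¬ D.Contained w v := by
  rcases h with h | h
  · exact fun h' => not_int_of_cont D h' (int_symm D h.2)
  · exact absurd h hc

theorem tvert_encIn (D : ChordDiagram n) {v w : Fin n} (h : ain D v w) :
    (LID D).tvert (encIn D v w) = v := by
  unfold encIn tvert
  by_cases hc : D.Contained v w
  · simp only [if_pos hc, mem_red, if_true]
  · have := not_cont_of_ain D h hc
    simp only [if_neg hc, mem_red, if_neg this]
    simp

theorem src_encIn (D : ChordDiagram n) {v w : Fin n} (h : ain D v w) :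
    (LID D).src (encIn D v w) = w := by
  unfold encIn src
  by_cases hc : D.Contained v w
  · simp only [if_pos hc, mem_red, eq_true hc, true_and, if_true]
  · have := not_cont_of_ain D h hc
    simp only [if_neg hc, mem_red, eq_false this, false_and, if_false]

theorem tvert_encOut (D : ChordDiagram n) (v w : Fin n) :
    (LID D).tvert (encOut v w) = v := by
  simp [encOut, tvert]

theorem src_encOut (D : ChordDiagram n) (v w : Fin n) :
    (LID D).src (encOut v w) = v := by
  simp [encOut, src]

theorem encIn_snd (D : ChordDiagram n) (v w : Fin n) : (encIn D v w).2 = false := by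
  unfold encIn; split_ifs <;> rfl

theorem encIn_ne_encOut (D : ChordDiagram n) (v w v' w' : Fin n) :
    encIn D v w ≠ encOut v' w' := by
  intro h
  have := congrArg Prod.snd h
  rw [encIn_snd] at this
  exact absurd this (by simp [encOut])

theorem encIn_inj (D : ChordDiagram n) {v w v' w' : Fin n} (h : ain D v w) (h' : ain D v' w')
    (e : encIn D v w = encIn D v' w') : v = v' ∧ w = w' := by
  constructor
  · rw [← tvert_encIn D h, e, tvert_encIn D h']
  · rw [← src_encIn D h, e, src_encIn D h']

theorem encOut_inj {v w v' w' : Fin n} (e : encOut v w = encOut v' w') : v = v' ∧ w = w' := by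
  simpa [encOut] using e

theorem ends_encIn (D : ChordDiagram n) (v w u : Fin n) :
    ((if (encIn D v w).1.1 = u then 1 else 0) + (if (encIn D v w).1.2 = u then 1 else 0) : ℕ) =
      (if v = u then 1 else 0) + (if w = u then 1 else 0) := by
  unfold encIn
  split_ifs <;> simp_all

theorem ends_encOut (v w u : Fin n) :
    ((if (encOut v w).1.1 = u then 1 else 0) + (if (encOut v w).1.2 = u then 1 else 0) : ℕ) =
      (if v = u then 1 else 0) + (if w = u then 1 else 0) := rfl

/-- Local choices for all vertices. -/
abbrev Sel (n : ℕ) := Fin n → Option (Fin n) × Option (Fin n)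

/-- All choices are allowed. -/
def SelOk (D : ChordDiagram n) (s : Sel n) : Prop :=
  ∀ v, (∀ w, (s v).1 = some w → ain D v w) ∧ (∀ w, (s v).2 = some w → v = w ∨ aout D v w)

/-- The arcs thickened at `v`. -/
def Kloc (D : ChordDiagram n) (s : Sel n) (v : Fin n) : Finset (TArc (Fin n)) :=
  ((s v).1.elim ∅ fun w => {encIn D v w}) ∪ ((s v).2.elim ∅ fun w => {encOut v w})

/-- The collection of thickened arcs. -/
def Kof (D : ChordDiagram n) (s : Sel n) : Finset (TArc (Fin n)) :=
  univ.biUnion (Kloc D s)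

theorem mem_Kloc (D : ChordDiagram n) (s : Sel n) (v : Fin n) (t : TArc (Fin n)) :
    t ∈ Kloc D s v ↔ (∃ w, (s v).1 = some w ∧ t = encIn D v w) ∨
      (∃ w, (s v).2 = some w ∧ t = encOut v w) := by
  unfold Kloc
  rw [mem_union]
  cases (s v).1 <;> cases (s v).2 <;> simp

theorem mem_Kof (D : ChordDiagram n) (s : Sel n) (t : TArc (Fin n)) :
    t ∈ Kof D s ↔ ∃ v, (∃ w, (s v).1 = some w ∧ t = encIn D v w) ∨
      (∃ w, (s v).2 = some w ∧ t = encOut v w) := by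
  simp [Kof, mem_Kloc]

theorem encIn_mem_Kof (D : ChordDiagram n) {s : Sel n} (hs : SelOk D s) {v w : Fin n}
    (h : ain D v w) : encIn D v w ∈ Kof D s ↔ (s v).1 = some w := by
  rw [mem_Kof]
  constructor
  · rintro ⟨v', ⟨w', h1, h2⟩ | ⟨w', h1, h2⟩⟩
    · obtain ⟨rfl, rfl⟩ := encIn_inj D h ((hs v').1 _ h1) h2
      exact h1
    · exact absurd h2 (encIn_ne_encOut D _ _ _ _)
  · intro h1
    exact ⟨v, Or.inl ⟨w, h1, rfl⟩⟩

theorem encOut_mem_Kof (D : ChordDiagram n) (s : Sel n) (v w : Fin n) :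
    encOut v w ∈ Kof D s ↔ (s v).2 = some w := by
  rw [mem_Kof]
  constructor
  · rintro ⟨v', ⟨w', h1, h2⟩ | ⟨w', h1, h2⟩⟩
    · exact absurd h2.symm (encIn_ne_encOut D _ _ _ _)
    · obtain ⟨rfl, rfl⟩ := encOut_inj h2
      exact h1
  · intro h1
    exact ⟨v, Or.inr ⟨w, h1, rfl⟩⟩

theorem sum_Kof (D : ChordDiagram n) {s : Sel n} (hs : SelOk D s) (F : TArc (Fin n) → ℕ) :
    ∑ t ∈ Kof D s, F t = ∑ v, ((s v).1.elim 0 (fun w => F (encIn D v w)) +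
      (s v).2.elim 0 (fun w => F (encOut v w))) := by
  unfold Kof
  rw [Finset.sum_biUnion]
  · refine Finset.sum_congr rfl fun v _ => ?_
    unfold Kloc
    rw [Finset.sum_union]
    · cases (s v).1 <;> cases (s v).2 <;> simp
    · cases (s v).1 <;> cases (s v).2 <;> simp [encIn_ne_encOut]
  · intro v _ v' _ hne
    rw [Function.onFun, Finset.disjoint_left]
    intro t ht ht'
    rw [mem_Kloc] at ht ht'
    have key : ∀ x, t ∈ Kloc D s x → (LID D).tvert t = x := by
      intro x hx
      rcases (mem_Kloc D s x t).1 hx with ⟨w, h1, rfl⟩ | ⟨w, h1, rfl⟩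
      · exact tvert_encIn D ((hs x).1 _ h1)
      · exact tvert_encOut D _ _
    rw [← mem_Kloc] at ht ht'
    exact hne ((key _ ht).symm.trans (key _ ht'))

/-- Number of arcs thickened at `u`. -/
def outs (s : Sel n) (u : Fin n) : ℕ :=
  (if (s u).1.isSome then 1 else 0) + (if (s u).2.isSome then 1 else 0)

/-- Number of thin ends at `u`. -/
def ins (s : Sel n) (u : Fin n) : ℕ :=
  (univ.filter fun v => (s v).1 = some u).card + (univ.filter fun v => (s v).2 = some u).card

theorem sum_thick (o : Fin n → Option (Fin n)) (u : Fin n) :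
    ∑ v, (o v).elim 0 (fun _ => if v = u then 1 else 0) =
      (if (o u).isSome then 1 else 0 : ℕ) := by
  rw [Finset.sum_eq_single u]
  · cases o u <;> simp
  · intro v _ hv
    cases o v <;> simp [hv]
  · simp

theorem sum_thin (o : Fin n → Option (Fin n)) (u : Fin n) :
    ∑ v, (o v).elim 0 (fun w => if w = u then 1 else 0) =
      (univ.filter fun v => o v = some u).card := by
  rw [Finset.card_filter]
  refine Finset.sum_congr rfl fun v _ => ?_
  cases o v <;> simp

theorem elim_add (o : Option (Fin n)) (f g : Fin n → ℕ) :
    o.elim 0 (fun w => f w + g w) = o.elim 0 f + o.elim 0 g := by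
  cases o <;> simp

theorem degAt_Kof (D : ChordDiagram n) {s : Sel n} (hs : SelOk D s) (u : Fin n) :
    degAt (Kof D s) u = outs s u + ins s u := by
  unfold degAt
  rw [sum_Kof D hs]
  simp only [ends_encIn, ends_encOut, elim_add, Finset.sum_add_distrib]
  rw [sum_thick (fun v => (s v).1), sum_thin (fun v => (s v).1), sum_thick (fun v => (s v).2),
    sum_thin (fun v => (s v).2)]
  unfold outs ins
  ring

theorem elim_congr' (o : Option (Fin n)) (f g : Fin n → ℕ) (h : ∀ w, o = some w → f w = g w) :
    o.elim 0 f = o.elim 0 g := by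
  cases o <;> simp [h]

theorem thickAt_Kof (D : ChordDiagram n) {s : Sel n} (hs : SelOk D s) (u : Fin n) :
    (LID D).thickAt (Kof D s) u = outs s u := by
  unfold thickAt
  rw [Finset.card_filter, sum_Kof D hs, Finset.sum_add_distrib]
  rw [Finset.sum_congr rfl fun v _ => elim_congr' (s v).1 _ (fun _ => if v = u then 1 else 0)
    fun w hw => by rw [tvert_encIn D ((hs v).1 w hw)]]
  simp only [tvert_encOut]
  rw [sum_thick (fun v => (s v).1), sum_thick (fun v => (s v).2)]
  rfl

theorem outThickAt_Kof (D : ChordDiagram n) {s : Sel n} (hs : SelOk D s) (u : Fin n) :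
    (LID D).outThickAt (Kof D s) u = if (s u).2.isSome then 1 else 0 := by
  unfold outThickAt
  rw [Finset.card_filter, sum_Kof D hs, Finset.sum_add_distrib]
  rw [Finset.sum_congr rfl fun v _ => elim_congr' (s v).1 _ (fun _ => 0)
    fun w hw => by
      rw [tvert_encIn D ((hs v).1 w hw), src_encIn D ((hs v).1 w hw), if_neg]
      rintro ⟨rfl, h⟩
      exact ain_ne D ((hs v).1 w hw) h.symm]
  simp only [tvert_encOut, src_encOut, and_self]
  rw [sum_thick (fun v => (s v).2)]
  rw [Finset.sum_eq_zero, zero_add]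
  intro v _
  cases (s v).1 <;> simp

theorem aK_Kof (D : ChordDiagram n) {s : Sel n} (hs : SelOk D s) :
    (LID D).aK (Kof D s) = ∑ v, if (s v).2.isSome then 1 else 0 := by
  unfold aK
  rw [Finset.card_filter, sum_Kof D hs]
  refine Finset.sum_congr rfl fun v _ => ?_
  rw [elim_congr' (s v).1 _ (fun _ => 0)
    fun w hw => by
      rw [tvert_encIn D ((hs v).1 w hw), src_encIn D ((hs v).1 w hw), if_neg]
      exact (ain_ne D ((hs v).1 w hw)).symm]
  simp only [tvert_encOut, src_encOut]
  cases (s v).1 <;> cases (s v).2 <;> simp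

theorem outs_le (s : Sel n) (u : Fin n) : outs s u ≤ 2 := by
  unfold outs; split_ifs <;> simp

theorem acceptable_Kof (D : ChordDiagram n) {s : Sel n} (hs : SelOk D s) :
    (LID D).IsAcceptable (Kof D s) ↔ ∀ u, ins s u = outs s u := by
  constructor
  · intro h u
    have := h.half_thick u
    rw [thickAt_Kof D hs, degAt_Kof D hs] at this
    omega
  · intro h
    refine ⟨?_, ?_, ?_, ?_, ?_⟩
    · intro t ht
      rw [mem_Kof] at ht
      obtain ⟨v, ⟨w, h1, rfl⟩ | ⟨w, h1, rfl⟩⟩ := ht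
      · have ha := (hs v).1 w h1
        unfold encIn
        split_ifs with hc
        · exact (mem_arcs' D _ _).2 (Or.inr (Or.inr hc))
        · rcases ha with ha | ha
          · exact (mem_arcs' D _ _).2 (Or.inr (Or.inl ⟨ha.1, int_symm D ha.2⟩))
          · exact absurd ha hc
      · exact (mem_arcs' D _ _).2 ((hs v).2 w h1)
    · intro t ht he
      rw [mem_Kof] at ht
      obtain ⟨v, ⟨w, h1, rfl⟩ | ⟨w, h1, rfl⟩⟩ := ht
      · have ha := ain_ne D ((hs v).1 w h1)
        unfold encIn at he
        split_ifs at he with hc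
        · exact absurd he ha
        · exact absurd he.symm ha
      · rfl
    · intro v
      rw [degAt_Kof D hs, h v]
      have := outs_le s v
      omega
    · intro v
      rw [degAt_Kof D hs, thickAt_Kof D hs, h v]
      omega
    · intro v
      rw [thickAt_Kof D hs, outThickAt_Kof D hs]
      unfold outs
      split_ifs <;> simp

theorem Kof_inj (D : ChordDiagram n) {s s' : Sel n} (hs : SelOk D s) (hs' : SelOk D s')
    (h : Kof D s = Kof D s') : s = s' := by
  funext v
  refine Prod.ext (Option.ext fun w => ?_) (Option.ext fun w => ?_)
  · constructor
    · intro h1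
      have ha := (hs v).1 w h1
      exact (encIn_mem_Kof D hs' ha).1 (h ▸ (encIn_mem_Kof D hs ha).2 h1)
    · intro h1
      have ha := (hs' v).1 w h1
      exact (encIn_mem_Kof D hs ha).1 (h ▸ (encIn_mem_Kof D hs' ha).2 h1)
  · have h1 := encOut_mem_Kof D s v w
    have h2 := encOut_mem_Kof D s' v w
    rw [← h1, ← h2, h]

theorem exists_enc (D : ChordDiagram n) (t : TArc (Fin n)) (h1 : t.1 ∈ (LID D).arcs)
    (h2 : t.1.1 = t.1.2 → t.2 = true) :
    (∃ v w, ain D v w ∧ t = encIn D v w) ∨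
    (∃ v w, (v = w ∨ aout D v w) ∧ t = encOut v w) := by
  obtain ⟨⟨a, b⟩, c⟩ := t
  rw [mem_arcs'] at h1
  cases c
  · left
    rcases h1 with h1 | h1
    · exact absurd (h2 h1) (by simp)
    · by_cases hc : D.Contained a b
      · exact ⟨a, b, Or.inr hc, by simp only [encIn, if_pos hc]⟩
      · rcases h1 with h1 | h1
        · have hc' : ¬ D.Contained b a := fun h => not_int_of_cont D h (int_symm D h1.2)
          exact ⟨b, a, Or.inl ⟨h1.1, int_symm D h1.2⟩, by simp only [encIn, if_neg hc']⟩
        · exact absurd h1 hc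
  · right
    exact ⟨a, b, h1, rfl⟩

theorem Kof_surj (D : ChordDiagram n) (K : Finset (TArc (Fin n)))
    (hK : (LID D).IsAcceptable K) : ∃ s, SelOk D s ∧ Kof D s = K := by
  classical
  have hsplit : ∀ v, (LID D).thickAt K v = (LID D).outThickAt K v +
      (K.filter fun t => (LID D).tvert t = v ∧ ¬ (LID D).src t = v).card := by
    intro v
    unfold thickAt outThickAt
    rw [← Finset.card_filter_add_card_filter_not (fun t => (LID D).src t = v),
      Finset.filter_filter, Finset.filter_filter]
  have hle : ∀ v, (LID D).outThickAt K v ≤ 1 ∧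
      (K.filter fun t => (LID D).tvert t = v ∧ ¬ (LID D).src t = v).card ≤ 1 := by
    intro v
    have h1 := hK.deg024 v
    have h2 := hK.half_thick v
    have h3 := hK.balance v
    have h4 := hsplit v
    omega
  have uin : ∀ v w w', ain D v w → ain D v w' → encIn D v w ∈ K → encIn D v w' ∈ K →
      w = w' := by
    intro v w w' h h' m m'
    have e := Finset.card_le_one.1 (hle v).2 (encIn D v w)
      (by rw [mem_filter, tvert_encIn D h, src_encIn D h]
          exact ⟨m, rfl, (ain_ne D h).symm⟩) (encIn D v w')
      (by rw [mem_filter, tvert_encIn D h', src_encIn D h']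
          exact ⟨m', rfl, (ain_ne D h').symm⟩)
    exact (encIn_inj D h h' e).2
  have uout : ∀ v w w', encOut v w ∈ K → encOut v w' ∈ K → w = w' := by
    intro v w w' m m'
    have e := Finset.card_le_one.1 (hle v).1 (encOut v w)
      (by rw [mem_filter, tvert_encOut, src_encOut]
          exact ⟨m, rfl, rfl⟩) (encOut v w')
      (by rw [mem_filter, tvert_encOut, src_encOut]
          exact ⟨m', rfl, rfl⟩)
    exact (encOut_inj e).2
  have ex : ∀ (P : Fin n → Prop), (∀ w w', P w → P w' → w = w') →
      ∃ o : Option (Fin n), ∀ w, o = some w ↔ P w := by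
    intro P hP
    by_cases h : ∃ w, P w
    · obtain ⟨w, hw⟩ := h
      refine ⟨some w, fun w' => ⟨?_, fun h' => by rw [hP _ _ hw h']⟩⟩
      intro e
      rwa [← Option.some.inj e]
    · exact ⟨none, fun w => ⟨fun e => (by cases e), fun hw => absurd ⟨w, hw⟩ h⟩⟩
  choose s1 hs1 using fun v => ex (fun w => ain D v w ∧ encIn D v w ∈ K)
    (fun w w' h h' => uin v w w' h.1 h'.1 h.2 h'.2)
  choose s2 hs2 using fun v => ex (fun w => encOut v w ∈ K) (fun w w' h h' => uout v w w' h h')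
  have hok : SelOk D (fun v => (s1 v, s2 v)) := by
    intro v
    refine ⟨fun w hw => ((hs1 v w).1 hw).1, fun w hw => ?_⟩
    exact (mem_arcs' D v w).1 (hK.mem_arcs _ ((hs2 v w).1 hw))
  refine ⟨fun v => (s1 v, s2 v), hok, ?_⟩
  ext t
  constructor
  · intro ht
    rw [mem_Kof] at ht
    obtain ⟨v, ⟨w, h1, rfl⟩ | ⟨w, h1, rfl⟩⟩ := ht
    · exact ((hs1 v w).1 h1).2
    · exact (hs2 v w).1 h1
  · intro ht
    rcases exists_enc D t (hK.mem_arcs t ht) (hK.loop_thick t ht) with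
      ⟨v, w, ha, rfl⟩ | ⟨v, w, ha, rfl⟩
    · exact (encIn_mem_Kof D hok ha).2 ((hs1 v w).2 ⟨ha, ht⟩)
    · exact (encOut_mem_Kof D _ v w).2 ((hs2 v w).2 ht)

/-- The local summand of `J`. -/
noncomputable def Jv (D : ChordDiagram n) (v : Fin n) (o : Option (Fin n) × Option (Fin n)) :
    Polynomial ℚ :=
  (o.1.elim 1 fun w => if ain D v w then 1 else 0) *
  (o.2.elim 1 fun w => if v = w ∨ aout D v w then -1 else 0) *
  (if o.1.isSome ∧ o.2.isSome then 2 else Polynomial.X + 2)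

theorem Jv_zero (D : ChordDiagram n) {s : Sel n} (hs : ¬ SelOk D s) :
    ∏ v, Jv D v (s v) = 0 := by
  unfold SelOk at hs
  push Not at hs
  obtain ⟨v, hv⟩ := hs
  refine Finset.prod_eq_zero (mem_univ v) ?_
  unfold Jv
  by_cases h : ∀ w, (s v).1 = some w → ain D v w
  · obtain ⟨w, h1, h2⟩ := hv h
    simp [h1, h2]
  · push Not at h
    obtain ⟨w, h1, h2⟩ := h
    simp [h1, h2]

theorem Jv_of_ok (D : ChordDiagram n) {s : Sel n} (hs : SelOk D s) (v : Fin n) :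
    Jv D v (s v) = (-1) ^ (if (s v).2.isSome then 1 else 0) *
      (if outs s v = 2 then 2 else Polynomial.X + 2) := by
  have h := hs v
  unfold Jv outs
  revert h
  rcases s v with ⟨_ | a, _ | b⟩ <;> simp +contextual

theorem weight_Kof (D : ChordDiagram n) {s : Sel n} (hs : SelOk D s)
    (hb : ∀ u, ins s u = outs s u) :
    (2 : Polynomial ℚ) ^ deg4 (Kof D s) *
      (Polynomial.X + 2) ^ (Fintype.card (Fin n) - deg4 (Kof D s)) *
      (∏ t ∈ Kof D s, (1 : Polynomial ℚ)) * (-1) ^ (LID D).aK (Kof D s) =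
    ∏ v, Jv D v (s v) := by
  rw [Finset.prod_congr rfl fun v _ => Jv_of_ok D hs v, Finset.prod_mul_distrib, aK_Kof D hs,
    Finset.prod_pow_eq_pow_sum, Finset.prod_const_one, Finset.prod_ite, Finset.prod_const,
    Finset.prod_const]
  have h1 : deg4 (Kof D s) = (univ.filter fun v => outs s v = 2).card := by
    unfold deg4
    congr 1
    ext v
    simp only [mem_filter, mem_univ, true_and, degAt_Kof D hs, hb v]
    omega
  have h2 : Fintype.card (Fin n) - deg4 (Kof D s) =
      (univ.filter fun v => ¬ outs s v = 2).card := by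
    rw [h1, ← Finset.card_univ,
      ← Finset.card_filter_add_card_filter_not (s := univ) (fun v => outs s v = 2)]
    omega
  rw [h2, h1]
  ring

theorem J_eq_sel (D : ChordDiagram n) :
    (LID D).J Polynomial.X (fun _ => (1 : Polynomial ℚ)) =
      ∑ s : Sel n, if (∀ u, ins s u = outs s u) then ∏ v, Jv D v (s v) else 0 := by
  classical
  unfold J
  have e : ∀ s : Sel n, (if (∀ u, ins s u = outs s u) then ∏ v, Jv D v (s v) else 0) =
      if SelOk D s ∧ (∀ u, ins s u = outs s u) then ∏ v, Jv D v (s v) else 0 := by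
    intro s
    by_cases hs : SelOk D s
    · simp only [hs, true_and]
    · simp only [hs, false_and, if_false, Jv_zero D hs, ite_self]
  rw [Finset.sum_congr rfl fun s _ => e s]
  symm
  rw [← Finset.sum_filter]
  refine Eq.trans ?_ (Finset.sum_filter (s := univ)
    (fun K : Finset (TArc (Fin n)) => (LID D).IsAcceptable K) _)
  refine Finset.sum_bij (fun s _ => Kof D s) ?_ ?_ ?_ ?_
  · intro s hs
    simp only [mem_filter, mem_univ, true_and] at hs ⊢
    exact (acceptable_Kof D hs.1).2 hs.2
  · intro s hs s' hs' h
    simp only [mem_filter, mem_univ, true_and] at hs hs'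
    exact Kof_inj D hs.1 hs'.1 h
  · intro K hK
    simp only [mem_filter, mem_univ, true_and] at hK
    obtain ⟨s, hs, rfl⟩ := Kof_surj D K hK
    refine ⟨s, ?_, rfl⟩
    simp only [mem_filter, mem_univ, true_and]
    exact ⟨hs, (acceptable_Kof D hs).1 hK⟩
  · intro s hs
    simp only [mem_filter, mem_univ, true_and] at hs
    exact (weight_Kof D hs.1 hs.2).symm

/-- Collapse `none` at `v` to `v`. -/
def coll (v : Fin n) (o : Option (Fin n) × Option (Fin n)) : Fin n × Fin n :=
  (o.1.getD v, o.2.getD v)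

theorem card_getD (o : Fin n → Option (Fin n)) (u : Fin n) :
    (univ.filter fun v => (o v).getD v = u).card + (if (o u).isSome then 1 else 0) =
      (univ.filter fun v => o v = some u).card + 1 := by
  rw [Finset.card_filter, Finset.card_filter, ← sum_thick o u, ← Finset.sum_add_distrib]
  have : (1 : ℕ) = ∑ v : Fin n, if v = u then 1 else 0 := by simp
  rw [this, ← Finset.sum_add_distrib]
  refine Finset.sum_congr rfl fun v _ => ?_
  cases o v <;> simp

theorem bal_iff (s : Sel n) (u : Fin n) :
    ins s u = outs s u ↔ inCount (fun v => coll v (s v)) u = 2 := by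
  have h1 := card_getD (fun v => (s v).1) u
  have h2 := card_getD (fun v => (s v).2) u
  have h3 : inCount (fun v => coll v (s v)) u =
      (univ.filter fun v => (s v).1.getD v = u).card +
      (univ.filter fun v => (s v).2.getD v = u).card := rfl
  rw [h3]
  simp only [ins, outs]
  omega

theorem sum_coll (D : ChordDiagram n) (v : Fin n) (p : Fin n × Fin n) :
    ∑ o ∈ univ.filter (fun o => coll v o = p), Jv D v o = Qv D v p.1 p.2 := by
  obtain ⟨a, b⟩ := p
  have hn1 : ¬ ain D v v := fun h => ain_ne D h rfl
  rw [Finset.sum_filter, Fintype.sum_prod_type]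
  simp only [Fintype.sum_option, coll, Prod.mk.injEq, Option.getD_none, Option.getD_some]
  unfold Jv Qv coef qv
  by_cases ha : v = a <;> by_cases hb : v = b
  · subst ha; subst hb
    simp [ite_and, hn1, Finset.sum_add_distrib]
  · subst ha
    simp [ite_and, hn1, hb, Ne.symm hb, Finset.sum_ite_eq]
  · subst hb
    simp [ite_and, hn1, ha, Ne.symm ha, Finset.sum_add_distrib]
    split_ifs <;> ring
  · simp [ite_and, ha, hb, Ne.symm ha, Ne.symm hb, Finset.sum_ite_eq]

theorem J_eq_normal (D : ChordDiagram n) :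
    (LID D).J Polynomial.X (fun _ => (1 : Polynomial ℚ)) =
      ∑ t : Fin n → Fin n × Fin n,
        if (∀ u, inCount t u = 2) then ∏ v, Qv D v (t v).1 (t v).2 else 0 := by
  classical
  rw [J_eq_sel]
  rw [← Finset.sum_fiberwise (s := univ) (g := fun (s : Sel n) => fun v => coll v (s v))]
  refine Finset.sum_congr rfl fun t _ => ?_
  have e : ∀ s ∈ univ.filter (fun s : Sel n => (fun v => coll v (s v)) = t),
      (if (∀ u, ins s u = outs s u) then ∏ v, Jv D v (s v) else 0) =
      if (∀ u, inCount t u = 2) then ∏ v, Jv D v (s v) else 0 := by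
    intro s hs
    simp only [mem_filter, mem_univ, true_and] at hs
    simp only [bal_iff, hs]
  rw [Finset.sum_congr rfl e]
  split_ifs with h
  · rw [Finset.prod_congr rfl fun v _ => (sum_coll D v (t v)).symm, Finset.prod_univ_sum]
    refine Finset.sum_congr ?_ fun s _ => rfl
    ext s
    simp [Fintype.mem_piFinset, funext_iff]
  · simp

end JSide

/-- **Theorem 4.** For every chord diagram `D`, the partition function of its labeled
intersection digraph evaluated at all variables equal to `1` equals the permanent of
the blown-up intersection matrix: `J(LID(D))|_{x_e=1} = Per(IM_J(D))` in `ℚ[λ]`. -/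
theorem J_LID_eq_perm_IMJ {n : ℕ} (D : ChordDiagram n) :
    (LID D).J Polynomial.X (fun _ => 1) = perm (ChordDiagram.IMJ D) := by
  rw [J_eq_normal, perm_IMJ_eq]
end
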